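/- arXiv:math/0509553 — 2 statements merged into one kernel-verified Lean document; each statement's English description precedes it below -/
import Mathlib

section
/- For every x < 0: μ((−∞,x]) = ∫_{ψ₋(−x)}^∞ n((−∞,−φ₋(l)]) · ρ(l) dl. (This is the analytic identity expressing that the two-sided stopping time T of Theorem 1 satisfies P(F_T ≤ x) = μ((−∞,x]) for x < 0.) -/
open MeasureTheory Filter
open scoped ENNReal Topology Classical

/-- Topological support of a Borel measure on ℝ. -/
def measSupport (μ : MeasureTheory.Measure ℝ) : Set ℝ :=
  {x | ∀ U : Set ℝ, IsOpen U → x ∈ U → 0 < μ U}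

/-- `D_μ(y) = ∫_{[0,y]} n([s,∞))⁻¹ dμ(s)` for `y ≥ 0` (equal to `0` for `y < 0`). -/
noncomputable def Dmu (μ n : MeasureTheory.Measure ℝ) (y : ℝ) : ℝ≥0∞ :=
  ∫⁻ s in Set.Icc (0 : ℝ) y, (n (Set.Ici s))⁻¹ ∂μ

/-- `G_μ(x) = ∫_{[x,0]} n((−∞,s])⁻¹ dμ(s)` for `x ≤ 0` (equal to `0` for `x > 0`). -/
noncomputable def Gmu (μ n : MeasureTheory.Measure ℝ) (x : ℝ) : ℝ≥0∞ :=
  ∫⁻ s in Set.Icc x (0 : ℝ), (n (Set.Iic s))⁻¹ ∂μ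

/-- The set `{y ≥ 0 : D_μ(y) > v}`; its infimum is the right-continuous inverse
`D_μ⁻¹(v)`, with `D_μ⁻¹(v) = ∞` when the set is empty. -/
def DinvSet (μ n : MeasureTheory.Measure ℝ) (v : ℝ≥0∞) : Set ℝ :=
  {y : ℝ | 0 ≤ y ∧ v < Dmu μ n y}

/-- The set `{x ≤ 0 : G_μ(x) > v}`; its supremum is the right-continuous inverse
`G_μ⁻¹(v)`, with `G_μ⁻¹(v) = −∞` when the set is empty. -/
def GinvSet (μ n : MeasureTheory.Measure ℝ) (v : ℝ≥0∞) : Set ℝ :=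
  {x : ℝ | x ≤ 0 ∧ v < Gmu μ n x}

/-- `μ̄(D_μ⁻¹(v))`, with the convention `μ̄(∞) = 0`. -/
noncomputable def mubarDinv (μ n : MeasureTheory.Measure ℝ) (v : ℝ≥0∞) : ℝ :=
  if (DinvSet μ n v).Nonempty then (μ (Set.Ici (sInf (DinvSet μ n v)))).toReal else 0

/-- `μ̄(G_μ⁻¹(v))`, with the convention `μ̄(−∞) = 1`. -/
noncomputable def mubarGinv (μ n : MeasureTheory.Measure ℝ) (v : ℝ≥0∞) : ℝ :=
  if (GinvSet μ n v).Nonempty then (μ (Set.Ici (sSup (GinvSet μ n v)))).toReal else 1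

/-- `n([D_μ⁻¹(v),∞))`, with the convention that it is `0` when `D_μ⁻¹(v) = ∞`. -/
noncomputable def nDinv (μ n : MeasureTheory.Measure ℝ) (v : ℝ≥0∞) : ℝ≥0∞ :=
  if (DinvSet μ n v).Nonempty then n (Set.Ici (sInf (DinvSet μ n v))) else 0

/-- `n((−∞,G_μ⁻¹(v)])`, with the convention that it is `0` when `G_μ⁻¹(v) = −∞`. -/
noncomputable def nGinv (μ n : MeasureTheory.Measure ℝ) (v : ℝ≥0∞) : ℝ≥0∞ :=
  if (GinvSet μ n v).Nonempty then n (Set.Iic (sSup (GinvSet μ n v))) else 0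

/-- The integrand `[n([s,∞)) · (1 + μ̄(s) − μ̄(G_μ⁻¹(D_μ(s))))]⁻¹` of `ψ₊`. -/
noncomputable def psiPlusIntegrand (μ n : MeasureTheory.Measure ℝ) (s : ℝ) : ℝ≥0∞ :=
  (n (Set.Ici s) *
    ENNReal.ofReal (1 + (μ (Set.Ici s)).toReal - mubarGinv μ n (Dmu μ n s)))⁻¹

/-- `ψ₊(y) = ∫_{[0,y]} [n([s,∞)) · (1 + μ̄(s) − μ̄(G_μ⁻¹(D_μ(s))))]⁻¹ dμ(s)`. -/
noncomputable def psiPlus (μ n : MeasureTheory.Measure ℝ) (y : ℝ) : ℝ≥0∞ :=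
  ∫⁻ s in Set.Icc (0 : ℝ) y, psiPlusIntegrand μ n s ∂μ

/-- The integrand `[n((−∞,s]) · (1 + μ̄(D_μ⁻¹(G_μ(s))) − μ̄(s))]⁻¹` of `ψ₋`. -/
noncomputable def psiMinusIntegrand (μ n : MeasureTheory.Measure ℝ) (s : ℝ) : ℝ≥0∞ :=
  (n (Set.Iic s) *
    ENNReal.ofReal (1 + mubarDinv μ n (Gmu μ n s) - (μ (Set.Ici s)).toReal))⁻¹

/-- `ψ₋(z) = ∫_{[−z,0]} [n((−∞,s]) · (1 + μ̄(D_μ⁻¹(G_μ(s))) − μ̄(s))]⁻¹ dμ(s)`. -/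
noncomputable def psiMinus (μ n : MeasureTheory.Measure ℝ) (z : ℝ) : ℝ≥0∞ :=
  ∫⁻ s in Set.Icc (-z) (0 : ℝ), psiMinusIntegrand μ n s ∂μ

/-- The set `{y ≥ 0 : ψ₊(y) ≥ l}` whose infimum is the left-continuous inverse `φ₊(l)`. -/
def phiPlusSet (μ n : MeasureTheory.Measure ℝ) (l : ℝ) : Set ℝ :=
  {y : ℝ | 0 ≤ y ∧ ENNReal.ofReal l ≤ psiPlus μ n y}

/-- The set `{z ≥ 0 : ψ₋(z) ≥ l}` whose infimum is the left-continuous inverse `φ₋(l)`. -/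
def phiMinusSet (μ n : MeasureTheory.Measure ℝ) (l : ℝ) : Set ℝ :=
  {z : ℝ | 0 ≤ z ∧ ENNReal.ofReal l ≤ psiMinus μ n z}

/-- `φ₊(l) = inf{y ≥ 0 : ψ₊(y) ≥ l}`. -/
noncomputable def phiPlus (μ n : MeasureTheory.Measure ℝ) (l : ℝ) : ℝ :=
  sInf (phiPlusSet μ n l)

/-- `φ₋(l) = inf{z ≥ 0 : ψ₋(z) ≥ l}`. -/
noncomputable def phiMinus (μ n : MeasureTheory.Measure ℝ) (l : ℝ) : ℝ :=
  sInf (phiMinusSet μ n l)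

/-- `n([φ₊(l),∞))`, with the convention that it is `0` when `φ₊(l) = inf ∅ = ∞`. -/
noncomputable def nPhiPlus (μ n : MeasureTheory.Measure ℝ) (l : ℝ) : ℝ≥0∞ :=
  if (phiPlusSet μ n l).Nonempty then n (Set.Ici (phiPlus μ n l)) else 0

/-- `n((−∞,−φ₋(l)])`, with the convention that it is `0` when `φ₋(l) = inf ∅ = ∞`. -/
noncomputable def nPhiMinus (μ n : MeasureTheory.Measure ℝ) (l : ℝ) : ℝ≥0∞ :=
  if (phiMinusSet μ n l).Nonempty then n (Set.Iic (-(phiMinus μ n l))) else 0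

/-- `∫₀^L [n((−∞,−φ₋(s)]) + n([φ₊(s),∞))] ds` for an upper limit `L ∈ [0,∞]`. -/
noncomputable def cutInt (μ n : MeasureTheory.Measure ℝ) (L : ℝ≥0∞) : ℝ≥0∞ :=
  ∫⁻ s in {s : ℝ | 0 < s ∧ ENNReal.ofReal s < L},
    (nPhiMinus μ n s + nPhiPlus μ n s)

/-- `exp(−a)` for `a ∈ [0,∞]`, with `exp(−∞) = 0`. -/
noncomputable def expNegE (a : ℝ≥0∞) : ℝ :=
  if a = ⊤ then 0 else Real.exp (-a.toReal)

/-- `ρ(l) = exp(−∫₀^l [n((−∞,−φ₋(s)]) + n([φ₊(s),∞))] ds)`. -/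
noncomputable def rho (μ n : MeasureTheory.Measure ℝ) (l : ℝ) : ℝ≥0∞ :=
  ENNReal.ofReal (expNegE (cutInt μ n (ENNReal.ofReal l)))


lemma aux_cdf (κ : Measure ℝ) [NullSingletonClass κ] (h0 : κ (Set.Iic 0) = 0)
    (hfin : ∀ᵐ s ∂κ, κ (Set.Iic s) < ⊤) (b : ℝ≥0∞) (hb : 0 < b) :
    κ {s | κ (Set.Iic s) < b} = min b (κ Set.univ) := by
  have hmono : Monotone (fun s => κ (Set.Iic s)) := fun s t h => measure_mono (Set.Iic_subset_Iic.2 h)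
  set E := {s | κ (Set.Iic s) < b} with hE
  have h0E : (0:ℝ) ∈ E := by simp [hE, h0, hb]
  by_cases hall : E = Set.univ
  · rw [hall, min_eq_right]
    have := tendsto_measure_Iic_atTop κ
    exact le_of_tendsto' this (fun s => by
      have : s ∈ E := hall ▸ Set.mem_univ s
      exact le_of_lt this)
  · obtain ⟨t, ht⟩ : ∃ t, t ∉ E := by
      by_contra! h; exact hall (Set.eq_univ_of_forall h)
    have hbdd : BddAbove E := ⟨t, fun s hs => by
      by_contra! h
      exact ht (lt_of_le_of_lt (hmono h.le) hs)⟩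
    set e := sSup E with he
    have hlt : ∀ s, s < e → s ∈ E := fun s hs => by
      obtain ⟨u, hu, hsu⟩ := exists_lt_of_lt_csSup ⟨0, h0E⟩ hs
      exact lt_of_le_of_lt (hmono hsu.le) hu
    have hgt : ∀ s, e < s → b ≤ κ (Set.Iic s) := fun s hs => by
      by_contra! h
      exact absurd (le_csSup hbdd h) (not_le.2 hs)
    have hEe : κ E = κ (Set.Iic e) := by
      apply le_antisymm
      · exact measure_mono fun s hs => le_csSup hbdd hs
      · rw [← measure_congr Iio_ae_eq_Iic]
        exact measure_mono fun s hs => hlt s hs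
    have hle : κ (Set.Iic e) ≤ b := by
      rw [← measure_congr Iio_ae_eq_Iic]
      obtain ⟨u, hu, hul, hut⟩ := exists_seq_strictMono_tendsto e
      have : Set.Iio e = ⋃ k, Set.Iic (u k) := by
        ext s; simp only [Set.mem_Iio, Set.mem_iUnion, Set.mem_Iic]
        constructor
        · intro h
          obtain ⟨k, hk⟩ := ((hut.eventually (lt_mem_nhds h))).exists
          exact ⟨k, hk.le⟩
        · rintro ⟨k, hk⟩; exact lt_of_le_of_lt hk (hul k)
      rw [this, Monotone.measure_iUnion]
      · exact iSup_le fun k => (hlt _ (hul k)).le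
      · exact fun i j h => Set.Iic_subset_Iic.2 (hu.monotone h)
    have hge : b ≤ κ (Set.Iic e) := by
      by_cases hex : ∃ t, e < t ∧ κ (Set.Iic t) < ⊤
      · obtain ⟨t, het, htf⟩ := hex
        obtain ⟨u, hu, hul, hut⟩ := exists_seq_strictAnti_tendsto' het
        have : Set.Iic e = ⋂ k, Set.Iic (u k) := by
          ext s; simp only [Set.mem_Iic, Set.mem_iInter]
          constructor
          · intro h k; exact h.trans (hul k).1.le
          · intro h; exact ge_of_tendsto' hut h
        rw [this, Antitone.measure_iInter]
        · exact le_iInf fun k => hgt _ (hul k).1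
        · exact fun i j h => Set.Iic_subset_Iic.2 (hu.antitone h)
        · exact fun k => measurableSet_Iic.nullMeasurableSet
        · exact ⟨0, (lt_of_le_of_lt (hmono (hul 0).2.le) htf).ne⟩
      · push Not at hex
        have hz : κ (Set.Ioi e) = 0 := by
          apply measure_mono_null _ hfin
          intro s hs
          simpa using hex s hs
        have h1 := hex (e+1) (by linarith)
        have h2 : κ (Set.Iic (e+1)) ≤ κ (Set.Iic e) + κ (Set.Ioi e) := by
          refine (measure_mono ?_).trans (measure_union_le _ _)
          rw [Set.Iic_union_Ioi]; exact Set.subset_univ _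
        rw [hz, add_zero] at h2
        exact (le_top.trans h1).trans h2
    rw [hEe, le_antisymm hle hge, min_eq_left (hge.trans (measure_mono (Set.subset_univ _)))]

lemma vol_min (M : ℝ≥0∞) (b : ℝ) :
    volume (Set.Iio b ∩ {l : ℝ | 0 < l ∧ ENNReal.ofReal l < M}) = min (ENNReal.ofReal b) M := by
  rcases eq_or_ne M ⊤ with rfl | hM
  · have : Set.Iio b ∩ {l : ℝ | 0 < l ∧ ENNReal.ofReal l < ⊤} = Set.Ioo 0 b := by
      ext x; simp; tauto
    rw [this]; simp
  · lift M to NNReal using hM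
    have : Set.Iio b ∩ {l : ℝ | 0 < l ∧ ENNReal.ofReal l < M} = Set.Ioo 0 (min b M) := by
      ext x
      simp only [Set.mem_inter_iff, Set.mem_Iio, Set.mem_ofPred_eq, Set.mem_Ioo, lt_min_iff]
      constructor
      · rintro ⟨h1, h2, h3⟩
        refine ⟨h2, h1, ?_⟩
        rwa [← ENNReal.ofReal_coe_nnreal, ENNReal.ofReal_lt_ofReal_iff_of_nonneg h2.le] at h3
      · rintro ⟨h2, h1, h3⟩
        refine ⟨h1, h2, ?_⟩
        rwa [← ENNReal.ofReal_coe_nnreal, ENNReal.ofReal_lt_ofReal_iff_of_nonneg h2.le]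
    rw [this, Real.volume_Ioo, sub_zero, ENNReal.ofReal_min, ENNReal.ofReal_coe_nnreal]

lemma tool_map (κ : Measure ℝ) [NullSingletonClass κ] (h0 : κ (Set.Iic 0) = 0)
    (hfin : ∀ᵐ s ∂κ, κ (Set.Iic s) < ⊤) :
    Measure.map (fun s => (κ (Set.Iic s)).toReal) κ =
      volume.restrict {l : ℝ | 0 < l ∧ ENNReal.ofReal l < κ Set.univ} := by
  have hmono : Monotone (fun s => κ (Set.Iic s)) := fun s t h => measure_mono (Set.Iic_subset_Iic.2 h)
  have hmeas : Measurable (fun s => (κ (Set.Iic s)).toReal) := hmono.measurable.ennreal_toReal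
  have key : ∀ b : ℝ, Measure.map (fun s => (κ (Set.Iic s)).toReal) κ (Set.Iio b) =
      min (ENNReal.ofReal b) (κ Set.univ) := by
    intro b
    rw [Measure.map_apply hmeas measurableSet_Iio]
    rcases le_or_gt b 0 with hb | hb
    · have : (fun s => (κ (Set.Iic s)).toReal) ⁻¹' Set.Iio b = ∅ := by
        ext s
        simp only [Set.mem_preimage, Set.mem_Iio, Set.mem_empty_iff_false, iff_false, not_lt]
        exact hb.trans ENNReal.toReal_nonneg
      rw [this, ENNReal.ofReal_of_nonpos hb]; simp
    · rw [← aux_cdf κ h0 hfin (ENNReal.ofReal b) (by simpa using hb)]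
      apply measure_congr
      filter_upwards [hfin] with s hs
      apply propext
      change (κ (Set.Iic s)).toReal < b ↔ κ (Set.Iic s) < ENNReal.ofReal b
      rw [ENNReal.lt_ofReal_iff_toReal_lt hs.ne]
  refine Measure.ext_of_generateFrom_of_iUnion (Set.range Set.Iio) (fun k : ℕ => Set.Iio (k:ℝ))
    (by rw [← borel_eq_generateFrom_Iio]; exact BorelSpace.measurable_eq) isPiSystem_Iio ?_ ?_ ?_ ?_
  · ext s; simp; exact exists_nat_gt s
  · intro k; exact ⟨_, rfl⟩
  · intro k; rw [key]; exact ne_of_lt (lt_of_le_of_lt (min_le_left _ _) ENNReal.ofReal_lt_top)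
  · rintro _ ⟨b, rfl⟩
    rw [key, Measure.restrict_apply measurableSet_Iio, vol_min]

lemma tool (κ : Measure ℝ) [NullSingletonClass κ] (h0 : κ (Set.Iic 0) = 0)
    (hfin : ∀ᵐ s ∂κ, κ (Set.Iic s) < ⊤) (g : ℝ → ℝ≥0∞) (hg : Measurable g) :
    ∫⁻ s, g (κ (Set.Iic s)).toReal ∂κ =
      ∫⁻ l in {l : ℝ | 0 < l ∧ ENNReal.ofReal l < κ Set.univ}, g l := by
  have hmono : Monotone (fun s => κ (Set.Iic s)) := fun s t h => measure_mono (Set.Iic_subset_Iic.2 h)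
  rw [← tool_map κ h0 hfin, lintegral_map hg hmono.measurable.ennreal_toReal]

/-- level sets are null -/
lemma tool_level (κ : Measure ℝ) [NullSingletonClass κ] (h0 : κ (Set.Iic 0) = 0)
    (hfin : ∀ᵐ s ∂κ, κ (Set.Iic s) < ⊤) (c : ℝ) :
    ∀ᵐ s ∂κ, (κ (Set.Iic s)).toReal ≠ c := by
  have hmono : Monotone (fun s => κ (Set.Iic s)) := fun s t h => measure_mono (Set.Iic_subset_Iic.2 h)
  have : Measure.map (fun s => (κ (Set.Iic s)).toReal) κ {c} = 0 := by
    rw [tool_map κ h0 hfin]; simp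
  rw [Measure.map_apply hmono.measurable.ennreal_toReal (measurableSet_singleton c)] at this
  rw [ae_iff]; simp only [ne_eq, not_not]; exact this

noncomputable def Kf (m : Measure ℝ) (N : ℝ → ℝ≥0∞) (y : ℝ) : ℝ≥0∞ := ∫⁻ s in Set.Iic y, (N s)⁻¹ ∂m

noncomputable def Af (m : Measure ℝ) (N : ℝ → ℝ≥0∞) (v : ℝ) : ℝ≥0∞ :=
  if ({y : ℝ | 0 ≤ y ∧ ENNReal.ofReal v ≤ Kf m N y}).Nonempty then
    N (sInf {y : ℝ | 0 ≤ y ∧ ENNReal.ofReal v ≤ Kf m N y}) else 0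

structure Side (m : Measure ℝ) (N : ℝ → ℝ≥0∞) : Prop where
  fin : IsFiniteMeasure m
  null : NullSingletonClass m
  m0 : m (Set.Iic 0) = 0
  anti : Antitone N
  ntop : ∀ s, 0 < s → N s < ⊤
  kfin : ∀ y, Kf m N y < ⊤

namespace Side
variable {m : Measure ℝ} {N : ℝ → ℝ≥0∞}

lemma kmono (m : Measure ℝ) (N : ℝ → ℝ≥0∞) : Monotone (Kf m N) := fun _ _ h =>
  lintegral_mono_set (Set.Iic_subset_Iic.2 h)

lemma kapply (m : Measure ℝ) (N : ℝ → ℝ≥0∞) (y : ℝ) :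
    m.withDensity (fun s => (N s)⁻¹) (Set.Iic y) = Kf m N y := by
  rw [withDensity_apply _ measurableSet_Iic, Kf]

lemma k_univ (m : Measure ℝ) (N : ℝ → ℝ≥0∞) :
    m.withDensity (fun s => (N s)⁻¹) Set.univ = ⨆ y, Kf m N y := by
  have := tendsto_measure_Iic_atTop (m.withDensity (fun s => (N s)⁻¹))
  simp only [kapply] at this
  exact tendsto_nhds_unique this (tendsto_atTop_iSup (kmono m N))

lemma pos (h : Side m N) : ∀ᵐ s ∂m, 0 < s := by
  rw [ae_iff]; simpa [Set.Iic_def] using h.m0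

lemma ntop_ae (h : Side m N) : ∀ᵐ s ∂m, N s ≠ ⊤ := by
  filter_upwards [h.pos] with s hs using (h.ntop s hs).ne

lemma nmeas (h : Side m N) : Measurable N := h.anti.measurable

lemma nzero_ae (h : Side m N) : ∀ᵐ s ∂m, N s ≠ 0 := by
  have : ∀ k : ℕ, ∀ᵐ s ∂m, s ∈ Set.Iic (k:ℝ) → N s ≠ 0 := by
    intro k
    have h1 : ∀ᵐ s ∂(m.restrict (Set.Iic (k:ℝ))), (N s)⁻¹ < ⊤ :=
      ae_lt_top h.nmeas.inv (h.kfin k).ne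
    rw [ae_restrict_iff' measurableSet_Iic] at h1
    filter_upwards [h1] with s hs hsk
    have := hs hsk
    rintro h0
    simp [h0] at this
  filter_upwards [ae_all_iff.2 this] with s hs
  obtain ⟨k, hk⟩ := exists_nat_ge s
  exact hs k hk

lemma ac1 (h : Side m N) : m ≪ m.withDensity (fun s => (N s)⁻¹) := by
  apply withDensity_absolutelyContinuous' h.nmeas.inv.aemeasurable
  filter_upwards [h.ntop_ae] with s hs
  simpa using hs

lemma instNull (h : Side m N) : NullSingletonClass (m.withDensity (fun s => (N s)⁻¹)) := by
  have := h.null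
  exact ⟨fun x => withDensity_absolutelyContinuous m _ (measure_singleton x)⟩

lemma k0 (h : Side m N) : m.withDensity (fun s => (N s)⁻¹) (Set.Iic 0) = 0 :=
  withDensity_absolutelyContinuous m _ h.m0

lemma kfin' (h : Side m N) : ∀ᵐ s ∂(m.withDensity (fun s => (N s)⁻¹)),
    m.withDensity (fun s => (N s)⁻¹) (Set.Iic s) < ⊤ :=
  Eventually.of_forall fun s => by rw [kapply]; exact h.kfin s

lemma level (h : Side m N) (c : ℝ) : ∀ᵐ s ∂m, (Kf m N s).toReal ≠ c := by
  have := h.instNull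
  have := h.ac1.ae_le (tool_level _ h.k0 h.kfin' c)
  simp only [kapply] at this
  exact this

lemma S1 (h : Side m N) (g : ℝ → ℝ≥0∞) (hg : Measurable g) :
    ∫⁻ s, g (Kf m N s).toReal * (N s)⁻¹ ∂m =
      ∫⁻ v in {v : ℝ | 0 < v ∧ ENNReal.ofReal v < ⨆ y, Kf m N y}, g v := by
  have := h.instNull
  have := tool _ h.k0 h.kfin' g hg
  rw [k_univ] at this
  rw [← this, lintegral_withDensity_eq_lintegral_mul _ (f := fun s => (N s)⁻¹) h.nmeas.inv]
  · simp only [kapply, Pi.mul_apply, mul_comm]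
  · simp only [kapply]
    exact hg.comp (kmono m N).measurable.ennreal_toReal

lemma A_anti (h : Side m N) : Antitone (Af m N) := by
  intro v w hvw
  unfold Af
  have hsub : {y : ℝ | 0 ≤ y ∧ ENNReal.ofReal w ≤ Kf m N y} ⊆
      {y : ℝ | 0 ≤ y ∧ ENNReal.ofReal v ≤ Kf m N y} :=
    fun y hy => ⟨hy.1, (ENNReal.ofReal_le_ofReal hvw).trans hy.2⟩
  by_cases hw : ({y : ℝ | 0 ≤ y ∧ ENNReal.ofReal w ≤ Kf m N y}).Nonempty
  · rw [if_pos hw, if_pos (hw.mono hsub)]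
    exact h.anti (csInf_le_csInf ⟨0, fun y hy => hy.1⟩ hw hsub)
  · rw [if_neg hw]; exact zero_le

lemma A_K (h : Side m N) : ∀ᵐ s ∂m, Af m N (Kf m N s).toReal = N s := by
  have hl : ∀ᵐ s ∂m, ∀ q : ℚ, (Kf m N s).toReal ≠ (Kf m N q).toReal :=
    ae_all_iff.2 fun q => h.level _
  filter_upwards [hl, h.pos] with s hs hs0
  have hK : ENNReal.ofReal (Kf m N s).toReal = Kf m N s := ENNReal.ofReal_toReal (h.kfin s).ne
  have hmem : s ∈ {y : ℝ | 0 ≤ y ∧ ENNReal.ofReal (Kf m N s).toReal ≤ Kf m N y} := ⟨hs0.le, hK.le⟩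
  unfold Af
  rw [if_pos ⟨s, hmem⟩]
  congr 1
  apply le_antisymm (csInf_le ⟨0, fun y hy => hy.1⟩ hmem)
  apply le_csInf ⟨s, hmem⟩
  rintro y ⟨hy0, hy⟩
  by_contra! hlt
  obtain ⟨q, hq1, hq2⟩ := exists_rat_btwn hlt
  rw [hK] at hy
  exact hs q (congrArg _ (le_antisymm (hy.trans (kmono m N hq1.le)) (kmono m N hq2.le)))

lemma A_zero (v : ℝ) (hv : ⨆ y, Kf m N y < ENNReal.ofReal v) : Af m N v = 0 := by
  unfold Af
  rw [if_neg]
  rintro ⟨y, hy0, hy⟩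
  exact absurd (hy.trans (le_iSup (Kf m N) y)) (not_le.2 hv)

lemma measurableSet_S (M : ℝ≥0∞) : MeasurableSet {v : ℝ | 0 < v ∧ ENNReal.ofReal v < M} :=
  measurableSet_Ioi.inter (measurableSet_lt ENNReal.measurable_ofReal measurable_const)

/-- Reduction of `Ioi 0` to `(0,M)` for a function vanishing above `M`. -/
lemma reduce (M : ℝ≥0∞) (f : ℝ → ℝ≥0∞) (hf : ∀ v, M < ENNReal.ofReal v → f v = 0) :
    ∫⁻ v in {v : ℝ | 0 < v ∧ ENNReal.ofReal v < M}, f v = ∫⁻ v in Set.Ioi (0:ℝ), f v := by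
  rw [← lintegral_indicator (measurableSet_S M), ← lintegral_indicator measurableSet_Ioi]
  apply lintegral_congr_ae
  have : ∀ᵐ v : ℝ, v ≠ M.toReal := by
    rw [ae_iff]; simp
  filter_upwards [this] with v hv
  by_cases h0 : 0 < v
  · rcases lt_trichotomy (ENNReal.ofReal v) M with h | h | h
    · rw [Set.indicator_of_mem (show v ∈ {v : ℝ | 0 < v ∧ ENNReal.ofReal v < M} from ⟨h0, h⟩),
        Set.indicator_of_mem (show v ∈ Set.Ioi (0:ℝ) from h0)]
    · exact absurd (by rw [← h, ENNReal.toReal_ofReal h0.le]) hv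
    · simp [Set.indicator, hf v h]
  · simp [Set.indicator, h0]

lemma S2 (h : Side m N) (g : ℝ → ℝ≥0∞) (hg : Measurable g) :
    ∫⁻ s, g (Kf m N s).toReal ∂m = ∫⁻ v in Set.Ioi (0:ℝ), g v * Af m N v := by
  rw [← reduce (⨆ y, Kf m N y) _ (fun v hv => by rw [A_zero v hv, mul_zero]),
    ← h.S1 (fun v => g v * Af m N v) (hg.mul h.A_anti.measurable)]
  apply lintegral_congr_ae
  filter_upwards [h.A_K, h.ntop_ae, h.nzero_ae] with s h1 h2 h3
  rw [h1, mul_assoc, ENNReal.mul_inv_cancel h3 h2, mul_one]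

lemma tail (h : Side m N) (v : ℝ) (hv : 0 ≤ v) :
    m {s | v < (Kf m N s).toReal} = ∫⁻ u in Set.Ioi v, Af m N u := by
  have hms : MeasurableSet {s | v < (Kf m N s).toReal} :=
    measurableSet_lt measurable_const (kmono m N).measurable.ennreal_toReal
  have := h.S2 ((Set.Ioi v).indicator 1) (measurable_one.indicator measurableSet_Ioi)
  rw [← lintegral_indicator_one hms]
  refine Eq.trans ?_ (this.trans ?_)
  · rfl
  rw [← lintegral_indicator measurableSet_Ioi, ← lintegral_indicator measurableSet_Ioi]
  apply lintegral_congr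
  intro u
  by_cases hu : v < u
  · simp [Set.indicator, hu, hv.trans_lt hu]
  · simp [Set.indicator, hu]

lemma total (h : Side m N) : m Set.univ = ∫⁻ u in Set.Ioi (0:ℝ), Af m N u := by
  simpa using h.S2 1 measurable_one

lemma tail_pos (h : Side m N) (v : ℝ) (hv : 0 ≤ v) (hM : ENNReal.ofReal v < ⨆ y, Kf m N y) :
    0 < ∫⁻ u in Set.Ioi v, Af m N u := by
  rw [← h.tail v hv, pos_iff_ne_zero]
  intro h0
  have h1 := h.S1 ((Set.Ioi v).indicator 1) (measurable_one.indicator measurableSet_Ioi)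
  have h2 : ∫⁻ s, ((Set.Ioi v).indicator 1 (Kf m N s).toReal) * (N s)⁻¹ ∂m = 0 := by
    rw [lintegral_eq_zero_iff']
    · have : ∀ᵐ s ∂m, ¬ (v < (Kf m N s).toReal) := by rw [ae_iff]; simpa using h0
      filter_upwards [this] with s hs
      simp [Set.indicator, hs]
    · exact (((measurable_one.indicator measurableSet_Ioi).comp
        (kmono m N).measurable.ennreal_toReal).mul h.nmeas.inv).aemeasurable
  rw [h2, lintegral_indicator_one measurableSet_Ioi, Measure.restrict_apply measurableSet_Ioi] at h1
  obtain ⟨w, hw0, hw1, hw2⟩ := ENNReal.lt_iff_exists_real_btwn.1 hM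
  have h3 : Set.Ioo v w ⊆ Set.Ioi v ∩ {v : ℝ | 0 < v ∧ ENNReal.ofReal v < ⨆ y, Kf m N y} := by
    rintro u ⟨h1, h2⟩
    exact ⟨h1, hv.trans_lt h1, (ENNReal.ofReal_le_ofReal h2.le).trans_lt hw2⟩
  have h4 := measure_mono_null h3 h1.symm
  rw [Real.volume_Ioo, ENNReal.ofReal_eq_zero] at h4
  have : v < w := by
    by_contra! hh
    exact absurd (ENNReal.ofReal_le_ofReal hh) (not_le.2 hw1)
  linarith

/-- closed tail -/
lemma tail_Ici (h : Side m N) (x : ℝ) :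
    m (Set.Ici x) = ∫⁻ u in Set.Ioi (Kf m N x).toReal, Af m N u := by
  rw [← h.tail _ ENNReal.toReal_nonneg]
  apply measure_congr
  filter_upwards [h.level (Kf m N x).toReal] with s hs
  apply propext
  change x ≤ s ↔ (Kf m N x).toReal < (Kf m N s).toReal
  constructor
  · intro hh
    exact lt_of_le_of_ne (ENNReal.toReal_mono (h.kfin s).ne (kmono m N hh)) hs.symm
  · intro hh
    by_contra! hc
    exact absurd (ENNReal.toReal_mono (h.kfin x).ne (kmono m N hc.le)) (not_le.2 hh)

end Side

def SS (L : ℝ≥0∞) : Set ℝ := {v : ℝ | 0 < v ∧ ENNReal.ofReal v < L}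

lemma SS_meas (L : ℝ≥0∞) : MeasurableSet (SS L) := Side.measurableSet_S L

lemma SS_mono {L L' : ℝ≥0∞} (h : L ≤ L') : SS L ⊆ SS L' := fun _ hv => ⟨hv.1, hv.2.trans_le h⟩

lemma SS_ofReal (v : ℝ) : SS (ENNReal.ofReal v) = Set.Ioo 0 v := by
  ext u
  constructor
  · rintro ⟨h1, h2⟩
    exact ⟨h1, (ENNReal.ofReal_lt_ofReal_iff_of_nonneg h1.le).1 h2⟩
  · rintro ⟨h1, h2⟩
    exact ⟨h1, (ENNReal.ofReal_lt_ofReal_iff_of_nonneg h1.le).2 h2⟩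

noncomputable def FF (a : ℝ → ℝ≥0∞) (v : ℝ) : ℝ≥0∞ := ∫⁻ u in Set.Ioi v, a u

noncomputable def HH (a : ℝ → ℝ≥0∞) (L : ℝ≥0∞) : ℝ≥0∞ := ∫⁻ v in SS L, (FF a v)⁻¹

structure Two (a : ℝ → ℝ≥0∞) (M : ℝ≥0∞) : Prop where
  meas : Measurable a
  one : ∫⁻ u in Set.Ioi (0:ℝ), a u = 1
  fpos : ∀ v, 0 ≤ v → ENNReal.ofReal v < M → 0 < FF a v

namespace Two
variable {a : ℝ → ℝ≥0∞} {M : ℝ≥0∞}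

lemma F_anti (a : ℝ → ℝ≥0∞) : Antitone (FF a) := fun _ _ h =>
  lintegral_mono_set (Set.Ioi_subset_Ioi h)

lemma F_le (h : Two a M) (v : ℝ) (hv : 0 ≤ v) : FF a v ≤ 1 := by
  rw [← h.one]; exact F_anti a hv

lemma F_ne_top (h : Two a M) (v : ℝ) (hv : 0 ≤ v) : FF a v ≠ ⊤ :=
  ((h.F_le v hv).trans_lt ENNReal.one_lt_top).ne

lemma F_meas (a : ℝ → ℝ≥0∞) : Measurable (FF a) := (F_anti a).measurable

lemma H_mono (a : ℝ → ℝ≥0∞) : Monotone (HH a) := fun _ _ h => lintegral_mono_set (SS_mono h)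

lemma H_fin (h : Two a M) (v : ℝ) (hv : 0 ≤ v) (hM : ENNReal.ofReal v < M) :
    HH a (ENNReal.ofReal v) < ⊤ := by
  unfold HH
  have h1 : ∫⁻ u in SS (ENNReal.ofReal v), (FF a u)⁻¹ ≤
      ∫⁻ u in SS (ENNReal.ofReal v), (FF a v)⁻¹ := by
    apply setLIntegral_mono' (SS_meas _)
    intro u hu
    rw [SS_ofReal] at hu
    exact ENNReal.inv_le_inv.2 (F_anti a hu.2.le)
  refine h1.trans_lt ?_
  rw [setLIntegral_const, SS_ofReal, Real.volume_Ioo]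
  exact ENNReal.mul_lt_top (ENNReal.inv_lt_top.2 (h.fpos v hv hM)) ENNReal.ofReal_lt_top

lemma H_strict (h : Two a M) (v : ℝ) (hv : 0 ≤ v) (hM : ENNReal.ofReal v < M) (L : ℝ≥0∞)
    (hL : ENNReal.ofReal v < L) : HH a (ENNReal.ofReal v) < HH a L := by
  obtain ⟨w, hw0, hw1, hw2⟩ := ENNReal.lt_iff_exists_real_btwn.1 hL
  have hvw : v < w := by
    by_contra! hh
    exact absurd (ENNReal.ofReal_le_ofReal hh) (not_le.2 hw1)
  have hd : Disjoint (SS (ENNReal.ofReal v)) (Set.Ioo v w) := by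
    rw [SS_ofReal, Set.disjoint_left]
    rintro u ⟨_, h2⟩ ⟨h3, _⟩
    linarith
  have hsub : SS (ENNReal.ofReal v) ∪ Set.Ioo v w ⊆ SS L := by
    rw [SS_ofReal]
    rintro u (⟨h1, h2⟩ | ⟨h1, h2⟩)
    · exact ⟨h1, (ENNReal.ofReal_le_ofReal h2.le).trans_lt hL⟩
    · exact ⟨by linarith, (ENNReal.ofReal_le_ofReal h2.le).trans_lt hw2⟩
  have h1 : HH a (ENNReal.ofReal v) + ∫⁻ u in Set.Ioo v w, (FF a u)⁻¹ ≤ HH a L := by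
    unfold HH
    rw [← lintegral_union measurableSet_Ioo hd]
    exact lintegral_mono_set hsub
  have h2 : ENNReal.ofReal (w - v) ≤ ∫⁻ u in Set.Ioo v w, (FF a u)⁻¹ := by
    rw [← Real.volume_Ioo, ← setLIntegral_one]
    apply setLIntegral_mono' measurableSet_Ioo
    intro u hu
    exact ENNReal.one_le_inv.2 (h.F_le u (hv.trans hu.1.le))
  have h3 : (0:ℝ≥0∞) < ENNReal.ofReal (w - v) := by simpa using hvw
  calc HH a (ENNReal.ofReal v) < HH a (ENNReal.ofReal v) + ENNReal.ofReal (w - v) :=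
        ENNReal.lt_add_right (h.H_fin v hv hM).ne h3.ne'
    _ ≤ _ := (add_le_add le_rfl h2).trans h1

lemma toolH (h : Two a M) (g : ℝ → ℝ≥0∞) (hg : Measurable g) :
    ∫⁻ v in SS M, g (HH a (ENNReal.ofReal v)).toReal * (FF a v)⁻¹ = ∫⁻ l in SS (HH a M), g l := by
  set κ := (volume.restrict (SS M)).withDensity (fun v => (FF a v)⁻¹) with hκ
  have hac : κ ≪ volume := (withDensity_absolutelyContinuous _ _).trans Measure.restrict_le_self.absolutelyContinuous
  have hnull : NullSingletonClass κ := ⟨fun x => hac (measure_singleton x)⟩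
  have hK : ∀ v ∈ SS M, κ (Set.Iic v) = HH a (ENNReal.ofReal v) := by
    intro v hv
    rw [hκ, withDensity_apply _ measurableSet_Iic, Measure.restrict_restrict measurableSet_Iic, HH,
      SS_ofReal]
    have : Set.Iic v ∩ SS M = Set.Ioc 0 v := by
      ext u
      constructor
      · rintro ⟨h1, h2, h3⟩; exact ⟨h2, h1⟩
      · rintro ⟨h1, h2⟩
        exact ⟨h2, h1, (ENNReal.ofReal_le_ofReal h2).trans_lt hv.2⟩
    rw [this]
    exact setLIntegral_congr Ioo_ae_eq_Ioc.symm
  have hin : ∀ᵐ s ∂κ, s ∈ SS M :=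
    (withDensity_absolutelyContinuous _ _).ae_le (ae_restrict_mem (SS_meas M))
  have h0 : κ (Set.Iic 0) = 0 := by
    apply measure_mono_null _ hin
    rintro s hs ⟨h1, _⟩
    exact absurd h1 (not_lt.2 hs)
  have hfin : ∀ᵐ s ∂κ, κ (Set.Iic s) < ⊤ := by
    filter_upwards [hin] with s hs
    rw [hK s hs]; exact h.H_fin s hs.1.le hs.2
  have huniv : κ Set.univ = HH a M := by
    rw [hκ, withDensity_apply _ MeasurableSet.univ, Measure.restrict_univ, HH]
  have := tool κ h0 hfin g hg
  rw [huniv] at this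
  change _ = ∫⁻ l in SS (HH a M), g l at this
  rw [← this]
  have hmono : Monotone (fun s => κ (Set.Iic s)) := fun s t h => measure_mono (Set.Iic_subset_Iic.2 h)
  have hw := lintegral_withDensity_eq_lintegral_mul (volume.restrict (SS M))
    (f := fun s => (FF a s)⁻¹) (F_meas a).inv
    (g := fun s => g (κ (Set.Iic s)).toReal) (hg.comp hmono.measurable.ennreal_toReal)
  rw [← hκ] at hw
  rw [hw]
  apply setLIntegral_congr_fun (SS_meas M)
  intro v hv
  simp only [Pi.mul_apply]
  rw [hK v hv, mul_comm]

lemma log_int (p : ℝ) (hp0 : 0 ≤ p) (hp : p < 1) :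
    ∫⁻ l in Set.Ioo 0 p, (ENNReal.ofReal (1 - l))⁻¹ = ENNReal.ofReal (-Real.log (1 - p)) := by
  have hne : ∀ l ∈ Set.uIcc 0 p, (1 - l) ≠ 0 := by
    intro l hl
    rw [Set.uIcc_of_le hp0] at hl
    have := hl.2
    linarith
  have hint : IntervalIntegrable (fun l : ℝ => (1 - l)⁻¹) volume 0 p := by
    apply ContinuousOn.intervalIntegrable
    exact (continuousOn_const.sub continuousOn_id).inv₀ hne
  have hval : ∫ l in (0:ℝ)..p, (1 - l)⁻¹ = -Real.log (1 - p) := by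
    have := intervalIntegral.integral_eq_sub_of_hasDerivAt (a := 0) (b := p)
      (f := fun l => - Real.log (1 - l)) (f' := fun l => (1 - l)⁻¹) (fun l hl => by
        have h1 : HasDerivAt (fun l : ℝ => 1 - l) (-1) l := by
          simpa using (hasDerivAt_id l).const_sub 1
        have := (h1.log (hne l hl)).neg
        have he : (1 - l)⁻¹ = -(-1 / (1 - l)) := by rw [neg_div, neg_neg, one_div]
        rw [he]
        exact this) hint
    rw [this]; simp
  rw [← hval, intervalIntegral.integral_of_le hp0, integral_Ioc_eq_integral_Ioo,
    ofReal_integral_eq_lintegral_ofReal]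
  · apply setLIntegral_congr_fun measurableSet_Ioo
    intro l hl
    have := hl.2
    exact (ENNReal.ofReal_inv_of_pos (by linarith)).symm
  · exact (intervalIntegrable_iff_integrableOn_Ioo_of_le hp0).1 hint
  · filter_upwards [ae_restrict_mem measurableSet_Ioo] with l hl
    have := hl.2
    simp only [Pi.zero_apply]
    exact inv_nonneg.2 (by linarith)

lemma logid (h : Two a M) (v : ℝ) (hv : 0 ≤ v) (hM : ENNReal.ofReal v < M) :
    ∫⁻ u in Set.Ioo 0 v, a u * (FF a u)⁻¹ = ENNReal.ofReal (-Real.log (FF a v).toReal) := by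
  set κ := (volume.restrict (Set.Ioi (0:ℝ))).withDensity a with hκ
  have hac : κ ≪ volume := (withDensity_absolutelyContinuous _ _).trans Measure.restrict_le_self.absolutelyContinuous
  have hnull : NullSingletonClass κ := ⟨fun x => hac (measure_singleton x)⟩
  have hmono : Monotone (fun s => κ (Set.Iic s)) := fun s t h => measure_mono (Set.Iic_subset_Iic.2 h)
  have huniv : κ Set.univ = 1 := by
    rw [hκ, withDensity_apply _ MeasurableSet.univ, Measure.restrict_univ, h.one]
  have hle : ∀ s, κ (Set.Iic s) ≤ 1 := fun s => huniv ▸ measure_mono (Set.subset_univ _)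
  have hfin' : ∀ s, κ (Set.Iic s) < ⊤ := fun s => (hle s).trans_lt ENNReal.one_lt_top
  have hsum : ∀ s, 0 ≤ s → κ (Set.Iic s) + FF a s = 1 := by
    intro s hs
    have h1 : FF a s = κ (Set.Ioi s) := by
      rw [hκ, withDensity_apply _ measurableSet_Ioi, Measure.restrict_restrict measurableSet_Ioi,
        Set.Ioi_inter_Ioi, max_eq_left hs, FF]
    rw [h1, ← huniv, ← measure_union (by
      rw [Set.disjoint_left]; intro u h1 h2; exact absurd (show u ≤ s from h1) (not_le.2 h2)) measurableSet_Ioi,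
      Set.Iic_union_Ioi]
  have hsumR : ∀ s, 0 ≤ s → (FF a s).toReal = 1 - (κ (Set.Iic s)).toReal := by
    intro s hs
    have := congrArg ENNReal.toReal (hsum s hs)
    rw [ENNReal.toReal_add (hfin' s).ne (h.F_ne_top s hs)] at this
    simp at this; linarith
  have hin : ∀ᵐ s ∂κ, s ∈ Set.Ioi (0:ℝ) :=
    (withDensity_absolutelyContinuous _ _).ae_le (ae_restrict_mem measurableSet_Ioi)
  have h0 : κ (Set.Iic 0) = 0 := by
    apply measure_mono_null _ hin
    rintro s hs h1
    exact absurd (show 0 < s from h1) (not_lt.2 hs)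
  have hfin : ∀ᵐ s ∂κ, κ (Set.Iic s) < ⊤ := Eventually.of_forall hfin'
  set p := (κ (Set.Iic v)).toReal with hp
  have hFv : 0 < (FF a v).toReal := ENNReal.toReal_pos (h.fpos v hv hM).ne' (h.F_ne_top v hv)
  have hp1 : p < 1 := by have := hsumR v hv; linarith
  have hp0 : 0 ≤ p := ENNReal.toReal_nonneg
  rw [hsumR v hv, ← hp, ← log_int p hp0 hp1]
  have ht := tool κ h0 hfin ((Set.Iio p).indicator fun l => (ENNReal.ofReal (1 - l))⁻¹)
    (Measurable.indicator (by fun_prop) measurableSet_Iio)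
  rw [setLIntegral_indicator measurableSet_Iio, huniv] at ht
  have hset : Set.Iio p ∩ {l : ℝ | 0 < l ∧ ENNReal.ofReal l < 1} = Set.Ioo 0 p := by
    ext l
    constructor
    · rintro ⟨h1, h2, _⟩; exact ⟨h2, h1⟩
    · rintro ⟨h1, h2⟩
      exact ⟨h2, h1, by rw [ENNReal.ofReal_lt_one]; linarith⟩
  rw [hset] at ht
  rw [← ht]
  have hcongr : ∫⁻ s, (Set.Iio p).indicator (fun l => (ENNReal.ofReal (1 - l))⁻¹) (κ (Set.Iic s)).toReal ∂κ
      = ∫⁻ s, (Set.Iio v).indicator (fun u => (FF a u)⁻¹) s ∂κ := by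
    apply lintegral_congr_ae
    filter_upwards [hin, tool_level κ h0 hfin p] with s hs hlev
    have hs0 : (0:ℝ) < s := hs
    have hiff : (κ (Set.Iic s)).toReal < p ↔ s < v := by
      constructor
      · intro hh
        by_contra! hc
        exact absurd (ENNReal.toReal_mono (hfin' s).ne (hmono hc)) (not_le.2 hh)
      · intro hh
        exact lt_of_le_of_ne (ENNReal.toReal_mono (hfin' v).ne (hmono hh.le)) hlev
    have hF : (ENNReal.ofReal (1 - (κ (Set.Iic s)).toReal)) = FF a s := by
      rw [← hsumR s hs0.le, ENNReal.ofReal_toReal (h.F_ne_top s hs0.le)]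
    by_cases hc : s < v
    · rw [Set.indicator_of_mem (show _ ∈ Set.Iio p from hiff.2 hc),
        Set.indicator_of_mem (show s ∈ Set.Iio v from hc), hF]
    · rw [Set.indicator_of_notMem (show _ ∉ Set.Iio p from fun hh => hc (hiff.1 hh)),
        Set.indicator_of_notMem (show s ∉ Set.Iio v from hc)]
  rw [hcongr, hκ, lintegral_withDensity_eq_lintegral_mul _ h.meas
    (g := (Set.Iio v).indicator fun u => (FF a u)⁻¹) ((F_meas a).inv.indicator measurableSet_Iio)]
  have : (a * (Set.Iio v).indicator fun u => (FF a u)⁻¹) =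
      (Set.Iio v).indicator (fun u => a u * (FF a u)⁻¹) := by
    ext u; by_cases hu : u < v <;> simp [Set.indicator, hu]
  rw [this, setLIntegral_indicator measurableSet_Iio, Set.inter_comm]
  rfl

end Two

lemma expNegE_anti : Antitone expNegE := by
  intro x y hxy
  unfold expNegE
  by_cases hy : y = ⊤
  · rw [if_pos hy]; split_ifs
    · exact le_rfl
    · exact (Real.exp_pos _).le
  · have hx : x ≠ ⊤ := (hxy.trans_lt (lt_top_iff_ne_top.2 hy)).ne
    rw [if_neg hy, if_neg hx]
    exact Real.exp_le_exp.2 (neg_le_neg (ENNReal.toReal_mono hy hxy))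

namespace Two
variable {a : ℝ → ℝ≥0∞} {M : ℝ≥0∞}

lemma rho_eq (h : Two a M) (p : ℝ → ℝ≥0∞) (hp : Measurable p)
    (hpa : ∀ v ∈ SS M, p (HH a (ENNReal.ofReal v)).toReal = a v) (v : ℝ) (hv : v ∈ SS M) :
    ENNReal.ofReal (expNegE (∫⁻ s in SS (ENNReal.ofReal (HH a (ENNReal.ofReal v)).toReal), p s)) = FF a v := by
  have hHf := h.H_fin v hv.1.le hv.2
  rw [ENNReal.ofReal_toReal hHf.ne]
  have h1 := h.toolH ((SS (HH a (ENNReal.ofReal v))).indicator p) (hp.indicator (SS_meas _))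
  rw [setLIntegral_indicator (SS_meas _),
    Set.inter_eq_left.2 (SS_mono (H_mono a hv.2.le))] at h1
  have h2 : ∫⁻ u in SS M, (SS (HH a (ENNReal.ofReal v))).indicator p (HH a (ENNReal.ofReal u)).toReal
      * (FF a u)⁻¹ = ∫⁻ u in SS M, (Set.Ioo 0 v).indicator (fun u => a u * (FF a u)⁻¹) u := by
    apply setLIntegral_congr_fun (SS_meas M)
    intro u hu
    have huf := h.H_fin u hu.1.le hu.2
    have hz : HH a (ENNReal.ofReal 0) = 0 := by
      rw [HH, SS_ofReal]; simp
    have hpos : 0 < HH a (ENNReal.ofReal u) := by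
      have hu' : ENNReal.ofReal 0 < ENNReal.ofReal u := by
        simpa using hu.1
      have := h.H_strict 0 le_rfl (hu'.trans hu.2) _ hu'
      rwa [hz] at this
    simp only
    by_cases hc : u < v
    · have hm : (HH a (ENNReal.ofReal u)).toReal ∈ SS (HH a (ENNReal.ofReal v)) := by
        refine ⟨ENNReal.toReal_pos hpos.ne' huf.ne, ?_⟩
        rw [ENNReal.ofReal_toReal huf.ne]
        exact h.H_strict u hu.1.le hu.2 _ ((ENNReal.ofReal_lt_ofReal_iff_of_nonneg hu.1.le).2 hc)
      rw [Set.indicator_of_mem hm, Set.indicator_of_mem (show u ∈ Set.Ioo 0 v from ⟨hu.1, hc⟩), hpa u hu]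
    · have hm : (HH a (ENNReal.ofReal u)).toReal ∉ SS (HH a (ENNReal.ofReal v)) := by
        rintro ⟨_, hh⟩
        rw [ENNReal.ofReal_toReal huf.ne] at hh
        exact absurd (H_mono a (ENNReal.ofReal_le_ofReal (not_lt.1 hc))) (not_le.2 hh)
      rw [Set.indicator_of_notMem hm, Set.indicator_of_notMem (fun hh => hc hh.2), zero_mul]
  have hsub : Set.Ioo 0 v ⊆ SS M := by
    rw [← SS_ofReal]; exact SS_mono hv.2.le
  rw [h2, setLIntegral_indicator measurableSet_Ioo, Set.inter_eq_left.2 hsub,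
    h.logid v hv.1.le hv.2] at h1
  have hFv : 0 < (FF a v).toReal := ENNReal.toReal_pos (h.fpos v hv.1.le hv.2).ne' (h.F_ne_top v hv.1.le)
  have hF1 : (FF a v).toReal ≤ 1 := by
    have := ENNReal.toReal_mono ENNReal.one_ne_top (h.F_le v hv.1.le)
    simpa using this
  rw [← h1, expNegE, if_neg ENNReal.ofReal_ne_top,
    ENNReal.toReal_ofReal (neg_nonneg.2 (Real.log_nonpos hFv.le hF1)), neg_neg, Real.exp_log hFv,
    ENNReal.ofReal_toReal (h.F_ne_top v hv.1.le)]

lemma final (h : Two a M) (p q A : ℝ → ℝ≥0∞) (hp : Measurable p) (hq : Measurable q)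
    (hpa : ∀ v ∈ SS M, p (HH a (ENNReal.ofReal v)).toReal = a v)
    (hqA : ∀ v ∈ SS M, q (HH a (ENNReal.ofReal v)).toReal = A v)
    (hq0 : ∀ l, HH a M < ENNReal.ofReal l → q l = 0)
    (hA0 : ∀ v, M < ENNReal.ofReal v → A v = 0) (c : ℝ) (hc : 0 ≤ c) :
    ∫⁻ l in {l : ℝ | 0 ≤ l ∧ HH a (ENNReal.ofReal c) ≤ ENNReal.ofReal l},
      q l * ENNReal.ofReal (expNegE (∫⁻ s in SS (ENNReal.ofReal l), p s)) =
    ∫⁻ v in Set.Ioi c, A v := by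
  set r : ℝ → ℝ≥0∞ := fun l => ENNReal.ofReal (expNegE (∫⁻ s in SS (ENNReal.ofReal l), p s)) with hr
  have hrm : Measurable r := by
    apply Antitone.measurable
    intro l l' hl
    exact ENNReal.ofReal_le_ofReal (expNegE_anti (lintegral_mono_set (SS_mono (ENNReal.ofReal_le_ofReal hl))))
  set T : Set ℝ := {l : ℝ | HH a (ENNReal.ofReal c) ≤ ENNReal.ofReal l} with hT
  have hTm : MeasurableSet T := measurableSet_le measurable_const ENNReal.measurable_ofReal
  have e1 : ∫⁻ l in {l : ℝ | 0 ≤ l ∧ HH a (ENNReal.ofReal c) ≤ ENNReal.ofReal l}, q l * r l =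
      ∫⁻ l in Set.Ioi (0:ℝ), T.indicator (fun l => q l * r l) l := by
    have : {l : ℝ | 0 ≤ l ∧ HH a (ENNReal.ofReal c) ≤ ENNReal.ofReal l} = T ∩ Set.Ici 0 := by
      ext l; exact and_comm
    rw [setLIntegral_congr Ioi_ae_eq_Ici, setLIntegral_indicator hTm, this]
  rw [e1, ← Side.reduce (HH a M) _ (fun l hl => by
    by_cases hh : l ∈ T
    · rw [Set.indicator_of_mem hh, hq0 l hl, zero_mul]
    · rw [Set.indicator_of_notMem hh])]
  change ∫⁻ l in SS (HH a M), T.indicator (fun l => q l * r l) l = _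
  rw [← h.toolH (T.indicator (fun l => q l * r l)) ((hq.mul hrm).indicator hTm)]
  have e2 : ∫⁻ v in SS M, T.indicator (fun l => q l * r l) (HH a (ENNReal.ofReal v)).toReal * (FF a v)⁻¹
      = ∫⁻ v in SS M, (Set.Ici c).indicator A v := by
    apply setLIntegral_congr_fun (SS_meas M)
    intro v hv
    have hvf := h.H_fin v hv.1.le hv.2
    simp only
    by_cases hcv : c ≤ v
    · have hm : (HH a (ENNReal.ofReal v)).toReal ∈ T := by
        change HH a (ENNReal.ofReal c) ≤ ENNReal.ofReal _
        rw [ENNReal.ofReal_toReal hvf.ne]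
        exact H_mono a (ENNReal.ofReal_le_ofReal hcv)
      rw [Set.indicator_of_mem hm, Set.indicator_of_mem (show v ∈ Set.Ici c from hcv), hqA v hv, hr]
      simp only
      rw [h.rho_eq p hp hpa v hv, mul_assoc, ENNReal.mul_inv_cancel (h.fpos v hv.1.le hv.2).ne'
        (h.F_ne_top v hv.1.le), mul_one]
    · have hm : (HH a (ENNReal.ofReal v)).toReal ∉ T := by
        intro hh
        change HH a (ENNReal.ofReal c) ≤ ENNReal.ofReal _ at hh
        rw [ENNReal.ofReal_toReal hvf.ne] at hh
        refine absurd hh (not_le.2 (h.H_strict v hv.1.le hv.2 _ ?_))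
        exact (ENNReal.ofReal_lt_ofReal_iff_of_nonneg hv.1.le).2 (not_le.1 hcv)
      rw [Set.indicator_of_notMem hm, Set.indicator_of_notMem (show v ∉ Set.Ici c from hcv), zero_mul]
  rw [e2]
  change ∫⁻ v in {v : ℝ | 0 < v ∧ ENNReal.ofReal v < M}, _ = _
  rw [Side.reduce M _ (fun v hv => by
    by_cases hh : v ∈ Set.Ici c
    · rw [Set.indicator_of_mem hh, hA0 v hv]
    · rw [Set.indicator_of_notMem hh]), setLIntegral_congr Ioi_ae_eq_Ici,
    setLIntegral_indicator measurableSet_Ici, Set.Ici_inter_Ici, max_eq_left hc,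
    setLIntegral_congr Ioi_ae_eq_Ici]

variable {m : Measure ℝ} {N : ℝ → ℝ≥0∞}

lemma psi_eq (hs : Side m N) (a : ℝ → ℝ≥0∞) (y : ℝ) :
    ∫⁻ s in Set.Iic y, (N s * FF a (Kf m N s).toReal)⁻¹ ∂m = HH a (Kf m N y) := by
  have h1 := hs.S1 ((SS (Kf m N y) ∪ Set.Iic 0).indicator fun v => (FF a v)⁻¹)
    ((F_meas a).inv.indicator ((SS_meas _).union measurableSet_Iic))
  have h2 : ∫⁻ v in SS (⨆ y, Kf m N y), (SS (Kf m N y) ∪ Set.Iic 0).indicator (fun v => (FF a v)⁻¹) v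
      = HH a (Kf m N y) := by
    rw [setLIntegral_indicator ((SS_meas _).union measurableSet_Iic), HH]
    congr 2
    ext v
    constructor
    · rintro ⟨h1 | h1, h2⟩
      · exact h1
      · exact absurd h2.1 (not_lt.2 h1)
    · intro h1
      exact ⟨Or.inl h1, SS_mono (le_iSup (Kf m N) y) h1⟩
  rw [← h2]
  refine Eq.trans ?_ h1
  rw [← lintegral_indicator measurableSet_Iic]
  apply lintegral_congr_ae
  filter_upwards [hs.ntop_ae, hs.nzero_ae, hs.level (Kf m N y).toReal] with s h3 h4 h5
  have hsf := (hs.kfin s).ne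
  by_cases hc : s ≤ y
  · have hlt : Kf m N s < Kf m N y :=
      lt_of_le_of_ne (Side.kmono m N hc) (fun hh => h5 (by rw [hh]))
    have hm : (Kf m N s).toReal ∈ SS (Kf m N y) ∪ Set.Iic 0 := by
      rcases eq_or_lt_of_le (ENNReal.toReal_nonneg (a := Kf m N s)) with hz | hz
      · exact Or.inr hz.symm.le
      · exact Or.inl ⟨hz, by rwa [ENNReal.ofReal_toReal hsf]⟩
    rw [Set.indicator_of_mem (show s ∈ Set.Iic y from hc), Set.indicator_of_mem hm,
      ENNReal.mul_inv (Or.inl h4) (Or.inl h3), mul_comm]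
  · have hle : Kf m N y ≤ Kf m N s := Side.kmono m N (not_le.1 hc).le
    have hm : (Kf m N s).toReal ∉ SS (Kf m N y) ∪ Set.Iic 0 := by
      rintro (⟨_, hh⟩ | hh)
      · rw [ENNReal.ofReal_toReal hsf] at hh
        exact absurd hle (not_le.2 hh)
      · have hz : (Kf m N s).toReal = 0 := le_antisymm hh ENNReal.toReal_nonneg
        have hz' : (Kf m N y).toReal = 0 :=
          le_antisymm (hz ▸ ENNReal.toReal_mono hsf hle) ENNReal.toReal_nonneg
        exact h5 (hz.trans hz'.symm)
    rw [Set.indicator_of_notMem (show s ∉ Set.Iic y from hc), Set.indicator_of_notMem hm, zero_mul]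

/-- abstract `nPhi`. -/
noncomputable def nP (m : Measure ℝ) (N : ℝ → ℝ≥0∞) (a : ℝ → ℝ≥0∞) (l : ℝ) : ℝ≥0∞ :=
  if ({y : ℝ | 0 ≤ y ∧ ENNReal.ofReal l ≤ HH a (Kf m N y)}).Nonempty then
    N (sInf {y : ℝ | 0 ≤ y ∧ ENNReal.ofReal l ≤ HH a (Kf m N y)}) else 0

lemma nP_meas (hs : Side m N) (a : ℝ → ℝ≥0∞) : Measurable (nP m N a) := by
  apply Antitone.measurable
  intro v w hvw
  unfold nP
  have hsub : {y : ℝ | 0 ≤ y ∧ ENNReal.ofReal w ≤ HH a (Kf m N y)} ⊆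
      {y : ℝ | 0 ≤ y ∧ ENNReal.ofReal v ≤ HH a (Kf m N y)} :=
    fun y hy => ⟨hy.1, (ENNReal.ofReal_le_ofReal hvw).trans hy.2⟩
  by_cases hw : ({y : ℝ | 0 ≤ y ∧ ENNReal.ofReal w ≤ HH a (Kf m N y)}).Nonempty
  · rw [if_pos hw, if_pos (hw.mono hsub)]
    exact hs.anti (csInf_le_csInf ⟨0, fun y hy => hy.1⟩ hw hsub)
  · rw [if_neg hw]; exact zero_le

lemma nP_zero (l : ℝ) (hl : HH a (⨆ y, Kf m N y) < ENNReal.ofReal l) : nP m N a l = 0 := by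
  unfold nP
  rw [if_neg]
  rintro ⟨y, _, hy⟩
  exact absurd (hy.trans (H_mono a (le_iSup (Kf m N) y))) (not_le.2 hl)

lemma nP_eq (h : Two a M) (v : ℝ) (hv : v ∈ SS M) :
    nP m N a (HH a (ENNReal.ofReal v)).toReal = Af m N v := by
  have hset : {y : ℝ | 0 ≤ y ∧ ENNReal.ofReal (HH a (ENNReal.ofReal v)).toReal ≤ HH a (Kf m N y)} =
      {y : ℝ | 0 ≤ y ∧ ENNReal.ofReal v ≤ Kf m N y} := by
    ext y
    rw [ENNReal.ofReal_toReal (h.H_fin v hv.1.le hv.2).ne]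
    refine and_congr_right fun _ => ⟨fun hh => ?_, fun hh => H_mono a hh⟩
    by_contra! hc
    have hf : Kf m N y ≠ ⊤ := (hc.trans ENNReal.ofReal_lt_top).ne
    have := h.H_strict (Kf m N y).toReal ENNReal.toReal_nonneg
      (by rw [ENNReal.ofReal_toReal hf]; exact hc.trans hv.2) (ENNReal.ofReal v)
      (by rwa [ENNReal.ofReal_toReal hf])
    rw [ENNReal.ofReal_toReal hf] at this
    exact absurd hh (not_le.2 this)
  unfold nP Af
  rw [hset]

end Two

namespace Conc

lemma kfin_aux (m : Measure ℝ) [IsFiniteMeasure m] (N : ℝ → ℝ≥0∞) (hN : Antitone N)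
    (hm0 : m (Set.Iic 0) = 0) (hsupp : ∀ x ∈ m.support, 0 < N x) (y : ℝ) : Kf m N y < ⊤ := by
  have hcpt : IsCompact (m.support ∩ Set.Icc 0 y) :=
    isCompact_Icc.inter_left Measure.isClosed_support
  obtain ⟨c, hc, hcb⟩ : ∃ c : ℝ≥0∞, c < ⊤ ∧ ∀ s ∈ m.support ∩ Set.Icc 0 y, (N s)⁻¹ ≤ c := by
    by_cases hne : (m.support ∩ Set.Icc 0 y).Nonempty
    · obtain ⟨t, ht, htm⟩ := hcpt.exists_isGreatest hne
      exact ⟨(N t)⁻¹, ENNReal.inv_lt_top.2 (hsupp t ht.1),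
        fun s hs => ENNReal.inv_le_inv.2 (hN (htm hs))⟩
    · exact ⟨0, ENNReal.zero_lt_top, fun s hs => absurd ⟨s, hs⟩ hne⟩
  have hpos : ∀ᵐ s ∂m, 0 < s := by rw [ae_iff]; simpa [Set.Iic_def] using hm0
  have hle : Kf m N y ≤ ∫⁻ s in Set.Iic y, c ∂m := by
    apply lintegral_mono_ae
    rw [ae_restrict_iff' measurableSet_Iic]
    filter_upwards [hpos, Measure.support_mem_ae (μ := m)] with s h1 h2 h3
    exact hcb s ⟨h2, h1.le, h3⟩
  refine hle.trans_lt ?_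
  rw [setLIntegral_const]
  exact ENNReal.mul_lt_top hc (measure_lt_top _ _)

noncomputable def m₁ (μ : Measure ℝ) : Measure ℝ := μ.restrict (Set.Ioi 0)
noncomputable def m₂ (μ : Measure ℝ) : Measure ℝ := (μ.restrict (Set.Iio 0)).map (MeasurableEquiv.neg ℝ)
noncomputable def N₁ (n : Measure ℝ) (s : ℝ) : ℝ≥0∞ := n (Set.Ici s)
noncomputable def N₂ (n : Measure ℝ) (s : ℝ) : ℝ≥0∞ := n (Set.Iic (-s))

variable {μ n : Measure ℝ}

lemma m₂_apply (s : Set ℝ) : m₂ μ s = μ.restrict (Set.Iio 0) (Neg.neg ⁻¹' s) := by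
  rw [m₂, MeasurableEquiv.map_apply]; rfl

lemma side₁ [IsProbabilityMeasure μ]
    (hatomless : ∀ x : ℝ, μ {x} = 0)
    (hnfin : ∀ s : ℝ, 0 < s → n (Set.Ici s) < ⊤ ∧ n (Set.Iic (-s)) < ⊤)
    (hnsupp : ∀ x ∈ measSupport μ, 0 < n (Set.Iic x) ∧ 0 < n (Set.Ici x)) : Side (m₁ μ) (N₁ n) := by
  have hf : IsFiniteMeasure (m₁ μ) := by unfold m₁; infer_instance
  have h0 : m₁ μ (Set.Iic 0) = 0 := by
    rw [m₁, Measure.restrict_apply measurableSet_Iic, Set.Iic_inter_Ioi, Set.Ioc_self, measure_empty]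
  have hanti : Antitone (N₁ n) := fun s t h => measure_mono (Set.Ici_subset_Ici.2 h)
  refine ⟨hf, ⟨fun x => ?_⟩, h0, hanti, fun s hs => (hnfin s hs).1,
    kfin_aux _ _ hanti h0 fun x hx => (hnsupp x ?_).2⟩
  · exact Measure.restrict_le_self.absolutelyContinuous (hatomless x)
  · intro U hU hxU
    exact ((Measure.mem_support_iff_forall x).1 hx U (hU.mem_nhds hxU)).trans_le
      (Measure.restrict_le_self U)

lemma side₂ [IsProbabilityMeasure μ]
    (hatomless : ∀ x : ℝ, μ {x} = 0)
    (hnfin : ∀ s : ℝ, 0 < s → n (Set.Ici s) < ⊤ ∧ n (Set.Iic (-s)) < ⊤)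
    (hnsupp : ∀ x ∈ measSupport μ, 0 < n (Set.Iic x) ∧ 0 < n (Set.Ici x)) : Side (m₂ μ) (N₂ n) := by
  have hf : IsFiniteMeasure (m₂ μ) := by unfold m₂; infer_instance
  have h0 : m₂ μ (Set.Iic 0) = 0 := by
    rw [m₂_apply, Measure.restrict_apply (measurableSet_Iic.preimage measurable_neg)]
    convert measure_empty (μ := μ)
    ext u
    simp only [Set.mem_inter_iff, Set.mem_preimage, Set.mem_Iic, Set.mem_Iio, Set.mem_empty_iff_false,
      iff_false]
    rintro ⟨h1, h2⟩; linarith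
  have hanti : Antitone (N₂ n) := fun s t h => measure_mono (Set.Iic_subset_Iic.2 (neg_le_neg h))
  refine ⟨hf, ⟨fun x => ?_⟩, h0, hanti, fun s hs => (hnfin s hs).2,
    kfin_aux _ _ hanti h0 fun x hx => (hnsupp (-x) ?_).1⟩
  · rw [m₂_apply]
    apply Measure.restrict_le_self.absolutelyContinuous
    have : (Neg.neg ⁻¹' {x} : Set ℝ) = {-x} := by ext u; simp [neg_eq_iff_eq_neg]
    rw [this]; exact hatomless _
  · intro U hU hxU
    have := (Measure.mem_support_iff_forall x).1 hx (Neg.neg ⁻¹' U)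
      ((hU.preimage continuous_neg).mem_nhds hxU)
    rw [m₂_apply] at this
    have he : (Neg.neg ⁻¹' (Neg.neg ⁻¹' U) : Set ℝ) = U := by ext u; simp
    rw [he] at this
    exact this.trans_le (Measure.restrict_le_self U)

lemma int₁ (hatomless : ∀ x : ℝ, μ {x} = 0) (g : ℝ → ℝ≥0∞) (y : ℝ) :
    ∫⁻ s in Set.Icc 0 y, g s ∂μ = ∫⁻ s in Set.Iic y, g s ∂(m₁ μ) := by
  have : NullSingletonClass μ := ⟨hatomless⟩
  rw [m₁, Measure.restrict_restrict measurableSet_Iic, Set.Iic_inter_Ioi]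
  exact setLIntegral_congr Ioc_ae_eq_Icc.symm

lemma int₂ (hatomless : ∀ x : ℝ, μ {x} = 0) (g : ℝ → ℝ≥0∞) (z : ℝ) :
    ∫⁻ s in Set.Icc (-z) 0, g s ∂μ = ∫⁻ s in Set.Iic z, g (-s) ∂(m₂ μ) := by
  have : NullSingletonClass μ := ⟨hatomless⟩
  rw [m₂, MeasurableEquiv.restrict_map, lintegral_map_equiv,
    Measure.restrict_restrict ((MeasurableEquiv.neg ℝ).measurable measurableSet_Iic)]
  have : (MeasurableEquiv.neg ℝ) ⁻¹' Set.Iic z ∩ Set.Iio 0 = Set.Ico (-z) 0 := by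
    ext u; simp [neg_le]
  rw [this]
  simp only [MeasurableEquiv.neg_apply, neg_neg]
  exact setLIntegral_congr Ico_ae_eq_Icc.symm

lemma Dmu_eq (hatomless : ∀ x : ℝ, μ {x} = 0) (y : ℝ) : Dmu μ n y = Kf (m₁ μ) (N₁ n) y :=
  int₁ hatomless _ y

lemma Gmu_eq (hatomless : ∀ x : ℝ, μ {x} = 0) (z : ℝ) : Gmu μ n (-z) = Kf (m₂ μ) (N₂ n) z :=
  int₂ hatomless (fun s => (n (Set.Iic s))⁻¹) z

lemma inv_tail {m : Measure ℝ} {N : ℝ → ℝ≥0∞} (hs : Side m N) (v : ℝ≥0∞) :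
    m {s | v < Kf m N s} = if ({y : ℝ | 0 ≤ y ∧ v < Kf m N y}).Nonempty then
      m (Set.Ici (sInf {y : ℝ | 0 ≤ y ∧ v < Kf m N y})) else 0 := by
  have := hs.null
  split_ifs with h
  · set e := sInf {y : ℝ | 0 ≤ y ∧ v < Kf m N y} with he
    have he0 : 0 ≤ e := le_csInf h fun y hy => hy.1
    rw [← measure_congr Ioi_ae_eq_Ici]
    apply measure_congr
    have hne : ∀ᵐ s ∂m, s ≠ e := by rw [ae_iff]; simp
    filter_upwards [hs.pos, hne] with s h1 h2
    apply propext
    change v < Kf m N s ↔ e < s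
    constructor
    · intro hh
      exact lt_of_le_of_ne (csInf_le ⟨0, fun y hy => hy.1⟩ ⟨h1.le, hh⟩) h2.symm
    · intro hh
      obtain ⟨y, hy, hys⟩ := exists_lt_of_csInf_lt h hh
      exact hy.2.trans_le (Side.kmono m N hys.le)
  · have : ∀ᵐ s ∂m, ¬ (v < Kf m N s) := by
      filter_upwards [hs.pos] with s h1 h2
      exact h ⟨s, h1.le, h2⟩
    rw [ae_iff] at this
    simpa using this

lemma m₁_Ici (e : ℝ) (he : 0 ≤ e) (hatomless : ∀ x : ℝ, μ {x} = 0) : m₁ μ (Set.Ici e) = μ (Set.Ici e) := by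
  have : NullSingletonClass μ := ⟨hatomless⟩
  rw [m₁, Measure.restrict_apply measurableSet_Ici, ← measure_congr (Ioi_ae_eq_Ici (a := e))]
  apply measure_congr
  have hne : ∀ᵐ s ∂μ, s ≠ e := by rw [ae_iff]; simp
  filter_upwards [hne] with s h2
  apply propext
  change (e ≤ s ∧ 0 < s) ↔ e < s
  exact ⟨fun h => lt_of_le_of_ne h.1 h2.symm, fun h => ⟨h.le, he.trans_lt h⟩⟩

lemma m₂_Ici (e : ℝ) (he : 0 ≤ e) (hatomless : ∀ x : ℝ, μ {x} = 0) : m₂ μ (Set.Ici e) = μ (Set.Iic (-e)) := by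
  have : NullSingletonClass μ := ⟨hatomless⟩
  rw [m₂_apply, Measure.restrict_apply (measurableSet_Ici.preimage measurable_neg),
    ← measure_congr (Iio_ae_eq_Iic (a := -e))]
  apply measure_congr
  have hne : ∀ᵐ s ∂μ, s ≠ -e := by rw [ae_iff]; simp
  filter_upwards [hne] with s h2
  apply propext
  change (e ≤ -s ∧ s < 0) ↔ s < -e
  exact ⟨fun h => lt_of_le_of_ne (by linarith [h.1]) h2, fun h => ⟨by linarith, by linarith⟩⟩

lemma compl_tail [IsProbabilityMeasure μ] (x : ℝ) (hatomless : ∀ x : ℝ, μ {x} = 0) :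
    (μ (Set.Ici x)).toReal = 1 - (μ (Set.Iic x)).toReal := by
  have : NullSingletonClass μ := ⟨hatomless⟩
  have h1 := measureReal_compl (μ := μ) (measurableSet_Iio (a := x))
  rw [Set.compl_Iio, probReal_univ] at h1
  rw [← measure_congr (Iio_ae_eq_Iic (a := x))]
  exact h1

section
variable [IsProbabilityMeasure μ]

lemma mubarDinv_eq (hatomless : ∀ x : ℝ, μ {x} = 0) (s₁ : Side (m₁ μ) (N₁ n)) (v : ℝ≥0∞) :
    mubarDinv μ n v = (m₁ μ {s | v < Kf (m₁ μ) (N₁ n) s}).toReal := by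
  rw [inv_tail s₁]
  unfold mubarDinv DinvSet
  simp only [Dmu_eq hatomless]
  split_ifs with h
  · rw [m₁_Ici _ (le_csInf h fun y hy => hy.1) hatomless]
  · simp

lemma mubarGinv_eq (hatomless : ∀ x : ℝ, μ {x} = 0) (s₂ : Side (m₂ μ) (N₂ n)) (v : ℝ≥0∞) :
    mubarGinv μ n v = 1 - (m₂ μ {s | v < Kf (m₂ μ) (N₂ n) s}).toReal := by
  rw [inv_tail s₂]
  have hset : GinvSet μ n v = -{y : ℝ | 0 ≤ y ∧ v < Kf (m₂ μ) (N₂ n) y} := by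
    ext x
    rw [Set.mem_neg]
    change (x ≤ 0 ∧ v < Gmu μ n x) ↔ (0 ≤ -x ∧ v < Kf (m₂ μ) (N₂ n) (-x))
    rw [← Gmu_eq hatomless, neg_neg, neg_nonneg]
  unfold mubarGinv
  rw [hset, Set.nonempty_neg]
  split_ifs with h
  · rw [m₂_Ici _ (le_csInf h fun y hy => hy.1) hatomless, Real.sSup_neg,
      compl_tail _ hatomless]
  · simp

lemma tail_real {m : Measure ℝ} {N : ℝ → ℝ≥0∞} (hs : Side m N) (v : ℝ≥0∞) (hv : v ≠ ⊤) :
    m {s | v < Kf m N s} = ∫⁻ u in Set.Ioi v.toReal, Af m N u := by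
  rw [← hs.tail _ ENNReal.toReal_nonneg]
  congr 1
  ext s
  exact (ENNReal.toReal_lt_toReal hv (hs.kfin s).ne).symm

lemma FF_add (A B : ℝ → ℝ≥0∞) (hA : Measurable A) (v : ℝ) :
    FF (fun u => A u + B u) v = FF A v + FF B v := lintegral_add_left hA _

noncomputable def aa (μ n : Measure ℝ) (v : ℝ) : ℝ≥0∞ := Af (m₂ μ) (N₂ n) v + Af (m₁ μ) (N₁ n) v

lemma total_one (hatomless : ∀ x : ℝ, μ {x} = 0) : m₂ μ Set.univ + m₁ μ Set.univ = 1 := by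
  have : NullSingletonClass μ := ⟨hatomless⟩
  rw [m₂_apply, m₁, Set.preimage_univ, Measure.restrict_apply_univ, Measure.restrict_apply_univ,
    measure_congr (Ioi_ae_eq_Ici), ← measure_union _ measurableSet_Ici, Set.Iio_union_Ici, measure_univ]
  rw [Set.disjoint_left]; intro u h1 h2; exact absurd (show u < 0 from h1) (not_lt.2 h2)

lemma two (hatomless : ∀ x : ℝ, μ {x} = 0) (s₁ : Side (m₁ μ) (N₁ n)) (s₂ : Side (m₂ μ) (N₂ n)) :
    Two (aa μ n) (⨆ y, Kf (m₂ μ) (N₂ n) y) := by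
  refine ⟨s₂.A_anti.measurable.add s₁.A_anti.measurable, ?_, fun v hv hM => ?_⟩
  · rw [← total_one hatomless, s₁.total, s₂.total]
    exact FF_add _ _ s₂.A_anti.measurable 0
  · exact (s₂.tail_pos v hv hM).trans_le (lintegral_mono fun u => le_self_add)

lemma psiPlus_eq (hatomless : ∀ x : ℝ, μ {x} = 0) (s₁ : Side (m₁ μ) (N₁ n)) (s₂ : Side (m₂ μ) (N₂ n))
    (y : ℝ) : psiPlus μ n y = HH (aa μ n) (Kf (m₁ μ) (N₁ n) y) := by
  rw [← Two.psi_eq s₁, psiPlus, int₁ hatomless]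
  have f₁ := s₁.fin
  have f₂ := s₂.fin
  apply lintegral_congr_ae
  filter_upwards [ae_restrict_of_ae s₁.pos] with s hs
  have hk := (s₁.kfin s).ne
  have e1 : m₁ μ (Set.Ici s) = FF (Af (m₁ μ) (N₁ n)) (Kf (m₁ μ) (N₁ n) s).toReal := s₁.tail_Ici s
  have e2 : m₂ μ {u | Kf (m₁ μ) (N₁ n) s < Kf (m₂ μ) (N₂ n) u} =
      FF (Af (m₂ μ) (N₂ n)) (Kf (m₁ μ) (N₁ n) s).toReal := tail_real s₂ _ hk
  have e3 : FF (aa μ n) (Kf (m₁ μ) (N₁ n) s).toReal =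
      m₂ μ {u | Kf (m₁ μ) (N₁ n) s < Kf (m₂ μ) (N₂ n) u} + m₁ μ (Set.Ici s) := by
    rw [e1, e2]; exact FF_add _ _ s₂.A_anti.measurable _
  unfold psiPlusIntegrand
  rw [mubarGinv_eq hatomless s₂, Dmu_eq hatomless, e3, ← m₁_Ici s hs.le hatomless]
  congr 2
  have e4 : 1 + (m₁ μ (Set.Ici s)).toReal - (1 - (m₂ μ {u | Kf (m₁ μ) (N₁ n) s < Kf (m₂ μ) (N₂ n) u}).toReal)
      = (m₂ μ {u | Kf (m₁ μ) (N₁ n) s < Kf (m₂ μ) (N₂ n) u} + m₁ μ (Set.Ici s)).toReal := by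
    rw [ENNReal.toReal_add (measure_ne_top _ _) (measure_ne_top _ _)]; ring
  rw [e4, ENNReal.ofReal_toReal (ENNReal.add_ne_top.2 ⟨measure_ne_top _ _, measure_ne_top _ _⟩)]

lemma psiMinus_eq (hatomless : ∀ x : ℝ, μ {x} = 0) (s₁ : Side (m₁ μ) (N₁ n)) (s₂ : Side (m₂ μ) (N₂ n))
    (y : ℝ) : psiMinus μ n y = HH (aa μ n) (Kf (m₂ μ) (N₂ n) y) := by
  rw [← Two.psi_eq s₂, psiMinus, int₂ hatomless]
  have f₁ := s₁.fin
  have f₂ := s₂.fin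
  apply lintegral_congr_ae
  filter_upwards [ae_restrict_of_ae s₂.pos] with s hs
  have hk := (s₂.kfin s).ne
  have e1 : m₂ μ (Set.Ici s) = FF (Af (m₂ μ) (N₂ n)) (Kf (m₂ μ) (N₂ n) s).toReal := s₂.tail_Ici s
  have e2 : m₁ μ {u | Kf (m₂ μ) (N₂ n) s < Kf (m₁ μ) (N₁ n) u} =
      FF (Af (m₁ μ) (N₁ n)) (Kf (m₂ μ) (N₂ n) s).toReal := tail_real s₁ _ hk
  have e3 : FF (aa μ n) (Kf (m₂ μ) (N₂ n) s).toReal =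
      m₂ μ (Set.Ici s) + m₁ μ {u | Kf (m₂ μ) (N₂ n) s < Kf (m₁ μ) (N₁ n) u} := by
    rw [e1, e2]; exact FF_add _ _ s₂.A_anti.measurable _
  unfold psiMinusIntegrand
  rw [mubarDinv_eq hatomless s₁, Gmu_eq hatomless, e3, compl_tail _ hatomless, ← m₂_Ici s hs.le hatomless]
  congr 2
  have e4 : 1 + (m₁ μ {u | Kf (m₂ μ) (N₂ n) s < Kf (m₁ μ) (N₁ n) u}).toReal - (1 - (m₂ μ (Set.Ici s)).toReal)
      = (m₂ μ (Set.Ici s) + m₁ μ {u | Kf (m₂ μ) (N₂ n) s < Kf (m₁ μ) (N₁ n) u}).toReal := by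
    rw [ENNReal.toReal_add (measure_ne_top _ _) (measure_ne_top _ _)]; ring
  rw [e4, ENNReal.ofReal_toReal (ENNReal.add_ne_top.2 ⟨measure_ne_top _ _, measure_ne_top _ _⟩)]

end

end Conc

/-- For every `x < 0`:
`μ((−∞,x]) = ∫_{ψ₋(−x)}^∞ n((−∞,−φ₋(l)]) · ρ(l) dl`, the analytic identity expressing
that the two-sided stopping time `T` satisfies `P(F_T ≤ x) = μ((−∞,x])`. -/
theorem lowerTailIdentity
    (μ n : MeasureTheory.Measure ℝ) [MeasureTheory.IsProbabilityMeasure μ]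
    (hatomless : ∀ x : ℝ, μ {x} = 0)
    (hneg : 0 < μ (Set.Iio (0 : ℝ))) (hpos : 0 < μ (Set.Ioi (0 : ℝ)))
    (hnfin : ∀ s : ℝ, 0 < s → n (Set.Ici s) < ⊤ ∧ n (Set.Iic (-s)) < ⊤)
    (hnsupp : ∀ x ∈ measSupport μ, 0 < n (Set.Iic x) ∧ 0 < n (Set.Ici x))
    (hcompat : (⨆ y : ℝ, Dmu μ n y) = (⨆ x : ℝ, Gmu μ n x))
    :
    ∀ x : ℝ, x < 0 →
      μ (Set.Iic x) =
        ∫⁻ l in {l : ℝ | 0 ≤ l ∧ psiMinus μ n (-x) ≤ ENNReal.ofReal l},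
          nPhiMinus μ n l * rho μ n l := by
  intro x hx
  have s₁ := Conc.side₁ hatomless hnfin hnsupp
  have s₂ := Conc.side₂ hatomless hnfin hnsupp
  have ht := Conc.two hatomless s₁ s₂
  have hplus : ∀ l, nPhiPlus μ n l = Two.nP (Conc.m₁ μ) (Conc.N₁ n) (Conc.aa μ n) l := by
    intro l
    unfold nPhiPlus phiPlus phiPlusSet Two.nP
    simp only [Conc.psiPlus_eq hatomless s₁ s₂]
    rfl
  have hminus : ∀ l, nPhiMinus μ n l = Two.nP (Conc.m₂ μ) (Conc.N₂ n) (Conc.aa μ n) l := by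
    intro l
    unfold nPhiMinus phiMinus phiMinusSet Two.nP
    simp only [Conc.psiMinus_eq hatomless s₁ s₂]
    rfl
  have hx0 : 0 ≤ -x := by linarith
  have hfin := ht.final
    (fun l => Two.nP (Conc.m₂ μ) (Conc.N₂ n) (Conc.aa μ n) l + Two.nP (Conc.m₁ μ) (Conc.N₁ n) (Conc.aa μ n) l)
    (Two.nP (Conc.m₂ μ) (Conc.N₂ n) (Conc.aa μ n)) (Af (Conc.m₂ μ) (Conc.N₂ n))
    ((Two.nP_meas s₂ _).add (Two.nP_meas s₁ _)) (Two.nP_meas s₂ _)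
    (fun v hv => by
      simp only [ht.nP_eq v hv]
      rfl)
    (fun v hv => ht.nP_eq v hv) (fun l hl => Two.nP_zero l hl) (fun v hv => Side.A_zero v hv)
    (Kf (Conc.m₂ μ) (Conc.N₂ n) (-x)).toReal ENNReal.toReal_nonneg
  rw [← s₂.tail_Ici, Conc.m₂_Ici _ hx0 hatomless, neg_neg,
    ENNReal.ofReal_toReal (s₂.kfin _).ne, ← Conc.psiMinus_eq hatomless s₁ s₂] at hfin
  rw [← hfin]
  simp only [rho, cutInt, hminus, hplus]
  rfl
end

section
/- Set c_μ = D_μ(∞) = G_μ(−∞). For every 0 ≤ t < c_μ: ∫₀^t [ n((−∞,G_μ⁻¹(v)]) + n([D_μ⁻¹(v),∞)) ] / (1 + μ̄(D_μ⁻¹(v)) − μ̄(G_μ⁻¹(v))) dv = −log( 1 + μ̄(D_μ⁻¹(t)) − μ̄(G_μ⁻¹(t)) ). Consequently, the same integral taken over [0, c_μ) equals +∞. -/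
open MeasureTheory Filter
open scoped ENNReal Topology Classical

lemma cont_Iic (ν : Measure ℝ) [NullSingletonClass ν] (h : ∀ y, ν (Set.Iic y) < ⊤) :
    Continuous (fun y => ν (Set.Iic y)) := by
  rw [continuous_iff_continuousAt]
  intro y0
  have key : Tendsto (fun y => ∫⁻ x, (Set.Iic y).indicator 1 x ∂ν) (𝓝 y0)
      (𝓝 (∫⁻ x, (Set.Iic y0).indicator 1 x ∂ν)) := by
    apply tendsto_lintegral_filter_of_dominated_convergence
      ((Set.Iic (y0 + 1)).indicator 1)
    · exact Eventually.of_forall fun y => measurable_one.indicator measurableSet_Iic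
    · have : ∀ᶠ y in 𝓝 y0, y < y0 + 1 := eventually_lt_nhds (by linarith)
      filter_upwards [this] with y hy
      refine Eventually.of_forall fun x => ?_
      exact Set.indicator_le_indicator_of_subset (Set.Iic_subset_Iic.2 hy.le) (fun _ => zero_le) x
    · rw [lintegral_indicator_one measurableSet_Iic]; exact (h _).ne
    · have : ∀ᵐ x ∂ν, x ≠ y0 := by
        rw [ae_iff]; simp
      filter_upwards [this] with x hx
      apply tendsto_const_nhds.congr'
      rcases lt_or_gt_of_ne hx with hx | hx
      · filter_upwards [eventually_gt_nhds hx] with y hy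
        rw [Set.indicator_of_mem (by exact hx.le), Set.indicator_of_mem (by exact hy.le)]
      · filter_upwards [eventually_lt_nhds hx] with y hy
        rw [Set.indicator_of_notMem (by simpa using hx),
          Set.indicator_of_notMem (by simpa using hy)]
  simpa [ContinuousAt, lintegral_indicator_one measurableSet_Iic] using key

lemma Ici_anti (n : Measure ℝ) : Antitone (fun s => n (Set.Ici s)) :=
  fun _ _ h => measure_mono (Set.Ici_subset_Ici.2 h)

lemma meas_inv (n : Measure ℝ) : Measurable (fun s : ℝ => (n (Set.Ici s))⁻¹) :=
  (Ici_anti n).measurable.inv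

lemma Dmu_mono (μ n : Measure ℝ) : Monotone (Dmu μ n) :=
  fun _ _ h => lintegral_mono_set (Set.Icc_subset_Icc_right h)

lemma Dmu_neg (μ n : Measure ℝ) {y : ℝ} (h : y < 0) : Dmu μ n y = 0 := by
  simp [Dmu, Set.Icc_eq_empty (not_le.2 h)]

lemma Dmu_zero (μ n : Measure ℝ) [NullSingletonClass μ] : Dmu μ n 0 = 0 := by
  simp [Dmu]

lemma Dmu_lt_top (μ n : Measure ℝ) [IsProbabilityMeasure μ]
    (hs : ∀ x ∈ μ.support, 0 < n (Set.Ici x)) (y : ℝ) : Dmu μ n y < ⊤ := by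
  have hae : ∀ᵐ x ∂μ, x ∈ μ.support := Measure.support_mem_ae
  by_cases hne : (μ.support ∩ Set.Icc 0 y).Nonempty
  · obtain ⟨b, hb, hmax⟩ := (isCompact_Icc.inter_left
      (Measure.isClosed_support (μ := μ))).exists_isGreatest hne
    calc Dmu μ n y ≤ ∫⁻ s in Set.Icc (0 : ℝ) y, (n (Set.Ici b))⁻¹ ∂μ := by
          apply lintegral_mono_ae
          filter_upwards [ae_restrict_of_ae hae, ae_restrict_mem measurableSet_Icc] with s h1 h2
          exact ENNReal.inv_le_inv.2 (Ici_anti n (hmax ⟨h1, h2⟩))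
      _ < ⊤ := by
          rw [lintegral_const]
          exact ENNReal.mul_lt_top (ENNReal.inv_lt_top.2 (hs b hb.1)) (measure_lt_top _ _)
  · have : Dmu μ n y = 0 := by
      unfold Dmu
      rw [Measure.restrict_eq_zero.2, lintegral_zero_measure]
      rw [measure_eq_zero_iff_ae_notMem]
      filter_upwards [hae] with x hx h2
      exact hne ⟨x, hx, h2⟩
    simp [this]

lemma Dmu_cont (μ n : Measure ℝ) [IsProbabilityMeasure μ] [NullSingletonClass μ]
    (hs : ∀ x ∈ μ.support, 0 < n (Set.Ici x)) : Continuous (Dmu μ n) := by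
  have e : ∀ y, Dmu μ n y =
      ((μ.restrict (Set.Ici 0)).withDensity (fun s : ℝ => (n (Set.Ici s))⁻¹)) (Set.Iic y) := by
    intro y
    rw [withDensity_apply _ measurableSet_Iic, Measure.restrict_restrict measurableSet_Iic,
      Set.inter_comm, Set.Ici_inter_Iic]
    rfl
  have := cont_Iic ((μ.restrict (Set.Ici 0)).withDensity (fun s : ℝ => (n (Set.Ici s))⁻¹))
    (fun y => by rw [← e]; exact Dmu_lt_top μ n hs y)
  exact this.congr (fun y => (e y).symm)

lemma DinvSet_nonempty {μ n : Measure ℝ} {v : ℝ≥0∞} (hv : v < ⨆ y, Dmu μ n y) :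
    (DinvSet μ n v).Nonempty := by
  obtain ⟨y, hy⟩ := lt_iSup_iff.1 hv
  refine ⟨y, ?_, hy⟩
  by_contra h
  rw [Dmu_neg μ n (not_le.1 h)] at hy
  exact not_lt_zero hy

lemma DinvSet_bdd (μ n : Measure ℝ) (v : ℝ≥0∞) : BddBelow (DinvSet μ n v) :=
  ⟨0, fun _ h => h.1⟩

lemma Dmu_sInf {μ n : Measure ℝ} [IsProbabilityMeasure μ] [NullSingletonClass μ]
    (hs : ∀ x ∈ μ.support, 0 < n (Set.Ici x)) {v : ℝ≥0∞} (hv : v < ⨆ y, Dmu μ n y) :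
    Dmu μ n (sInf (DinvSet μ n v)) = v := by
  have hc := Dmu_cont μ n hs
  apply le_antisymm
  · have h1 : sInf (DinvSet μ n v) ∈ closure (Set.Iio (sInf (DinvSet μ n v))) := by simp
    refine closure_minimal (t := {y | Dmu μ n y ≤ v}) ?_
      (isClosed_le hc continuous_const) h1
    intro y hy
    by_contra h
    simp only [Set.mem_ofPred_eq, not_le] at h
    have : y ∈ DinvSet μ n v := by
      refine ⟨?_, h⟩
      by_contra h'
      rw [Dmu_neg μ n (not_le.1 h')] at h
      exact not_lt_zero h
    exact absurd (csInf_le (DinvSet_bdd μ n v) this) (not_le.2 hy)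
  · have h1 := csInf_mem_closure (DinvSet_nonempty hv) (DinvSet_bdd μ n v)
    exact closure_minimal (t := {y | v ≤ Dmu μ n y}) (fun y hy => hy.2.le)
      (isClosed_le continuous_const hc) h1

lemma sInf_nonneg' (μ n : Measure ℝ) (v : ℝ≥0∞) : 0 ≤ sInf (DinvSet μ n v) :=
  Real.sInf_nonneg fun _ h => h.1

lemma sInf_mono {μ n : Measure ℝ} {v w : ℝ≥0∞} (hvw : v ≤ w) (hw : (DinvSet μ n w).Nonempty) :
    sInf (DinvSet μ n v) ≤ sInf (DinvSet μ n w) :=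
  csInf_le_csInf (DinvSet_bdd μ n v) hw fun _ h => ⟨h.1, hvw.trans_lt h.2⟩

lemma nDinv_anti (μ n : Measure ℝ) : Antitone (nDinv μ n) := by
  intro v w hvw
  unfold nDinv
  by_cases hw : (DinvSet μ n w).Nonempty
  · have hv : (DinvSet μ n v).Nonempty := hw.mono fun _ h => ⟨h.1, hvw.trans_lt h.2⟩
    rw [if_pos hw, if_pos hv]
    exact Ici_anti n (sInf_mono hvw hw)
  · rw [if_neg hw]; exact zero_le

lemma sInf_pos' {μ n : Measure ℝ} [IsProbabilityMeasure μ] [NullSingletonClass μ]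
    (hs : ∀ x ∈ μ.support, 0 < n (Set.Ici x)) {v : ℝ≥0∞} (hv0 : 0 < v)
    (hv : v < ⨆ y, Dmu μ n y) : 0 < sInf (DinvSet μ n v) := by
  refine lt_of_le_of_ne (sInf_nonneg' μ n v) fun h => ?_
  have := Dmu_sInf hs hv
  rw [← h, Dmu_zero] at this
  exact hv0.ne this

lemma nDinv_lt_top {μ n : Measure ℝ} [IsProbabilityMeasure μ] [NullSingletonClass μ]
    (hs : ∀ x ∈ μ.support, 0 < n (Set.Ici x)) (hf : ∀ s, 0 < s → n (Set.Ici s) < ⊤)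
    {v : ℝ≥0∞} (hv0 : 0 < v) (hv : v < ⨆ y, Dmu μ n y) : nDinv μ n v < ⊤ := by
  rw [nDinv, if_pos (DinvSet_nonempty hv)]
  exact hf _ (sInf_pos' hs hv0 hv)

lemma map_eq {μ n : Measure ℝ} [IsProbabilityMeasure μ] [NullSingletonClass μ]
    (hs : ∀ x ∈ μ.support, 0 < n (Set.Ici x)) {t : ℝ} 
    (ht : ENNReal.ofReal t < ⨆ y, Dmu μ n y) :
    AEMeasurable (fun v => sInf (DinvSet μ n (ENNReal.ofReal v)))
      (volume.restrict (Set.Ioo 0 t)) ∧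
    Measure.map (fun v => sInf (DinvSet μ n (ENNReal.ofReal v))) (volume.restrict (Set.Ioo 0 t))
      = (μ.restrict (Set.Icc 0 (sInf (DinvSet μ n (ENNReal.ofReal t))))).withDensity
        (fun s : ℝ => (n (Set.Ici s))⁻¹) := by
  have hlt : ∀ v ∈ Set.Ioo 0 t, ENNReal.ofReal v < ⨆ y, Dmu μ n y := fun v hv =>
    (ENNReal.ofReal_le_ofReal hv.2.le).trans_lt ht
  have hm : AEMeasurable (fun v => sInf (DinvSet μ n (ENNReal.ofReal v)))
      (volume.restrict (Set.Ioo 0 t)) := by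
    apply aemeasurable_restrict_of_monotoneOn measurableSet_Ioo
    intro v hv w hw hvw
    exact sInf_mono (ENNReal.ofReal_le_ofReal hvw) (DinvSet_nonempty (hlt w hw))
  refine ⟨hm, ?_⟩
  have : IsFiniteMeasure (volume.restrict (Set.Ioo 0 t)) := ⟨by simp⟩
  apply Measure.ext_of_Iic
  intro y
  rw [Measure.map_apply_of_aemeasurable hm measurableSet_Iic,
    withDensity_apply _ measurableSet_Iic, Measure.restrict_restrict measurableSet_Iic,
    Measure.restrict_apply' measurableSet_Ioo]
  have e : Set.Iic y ∩ Set.Icc 0 (sInf (DinvSet μ n (ENNReal.ofReal t)))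
      = Set.Icc 0 (min y (sInf (DinvSet μ n (ENNReal.ofReal t)))) := by
    ext x; simp; tauto
  rw [e]
  change _ = Dmu μ n _
  rw [(Dmu_mono μ n).map_min, Dmu_sInf hs ht]
  set m := min (Dmu μ n y) (ENNReal.ofReal t) with hmdef
  have hmt : m ≠ ⊤ := ne_top_of_le_ne_top ENNReal.ofReal_ne_top (min_le_right _ _)
  apply le_antisymm
  · calc _ ≤ volume (Set.Icc 0 m.toReal) := by
          apply measure_mono
          rintro v ⟨h1, h2⟩
          refine ⟨h2.1.le, ?_⟩
          rw [← ENNReal.ofReal_le_iff_le_toReal hmt, hmdef, le_min_iff]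
          refine ⟨?_, ENNReal.ofReal_le_ofReal h2.2.le⟩
          rw [← Dmu_sInf hs (hlt v h2)]
          exact Dmu_mono μ n h1
      _ = m := by simp [ENNReal.ofReal_toReal hmt]
  · calc m = volume (Set.Ioo 0 m.toReal) := by simp [ENNReal.ofReal_toReal hmt]
      _ ≤ _ := by
          apply measure_mono
          rintro v ⟨h1, h2⟩
          rw [← ENNReal.ofReal_lt_iff_lt_toReal h1.le hmt, hmdef, lt_min_iff] at h2
          refine ⟨?_, h1, (ENNReal.ofReal_lt_ofReal_iff_of_nonneg h1.le).1 h2.2⟩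
          refine csInf_le (DinvSet_bdd _ _ _) ⟨?_, h2.1⟩
          by_contra h'
          rw [Dmu_neg μ n (not_le.1 h')] at h2
          exact not_lt_zero h2.1

lemma lint_nDinv {μ n : Measure ℝ} [IsProbabilityMeasure μ] [NullSingletonClass μ]
    (hs : ∀ x ∈ μ.support, 0 < n (Set.Ici x)) (hf : ∀ s, 0 < s → n (Set.Ici s) < ⊤)
    {t : ℝ} (ht : ENNReal.ofReal t < ⨆ y, Dmu μ n y) :
    ∫⁻ v in Set.Ioo 0 t, nDinv μ n (ENNReal.ofReal v) =
      ENNReal.ofReal (μ.real (Set.Ici 0) - mubarDinv μ n (ENNReal.ofReal t)) := by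
  obtain ⟨hm, hmap⟩ := map_eq hs ht
  have h1 : ∫⁻ v in Set.Ioo 0 t, nDinv μ n (ENNReal.ofReal v) =
      ∫⁻ v in Set.Ioo 0 t, n (Set.Ici (sInf (DinvSet μ n (ENNReal.ofReal v)))) := by
    apply setLIntegral_congr_fun measurableSet_Ioo
    intro v hv
    have : (DinvSet μ n (ENNReal.ofReal v)).Nonempty :=
      DinvSet_nonempty ((ENNReal.ofReal_le_ofReal hv.2.le).trans_lt ht)
    simp only [nDinv, if_pos this]
  have hIci : Measurable (fun s => n (Set.Ici s)) := (Ici_anti n).measurable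
  set X := sInf (DinvSet μ n (ENNReal.ofReal t)) with hX
  have hX0 : 0 ≤ X := sInf_nonneg' _ _ _
  rw [h1, ← lintegral_map' (f := fun s => n (Set.Ici s)) hIci.aemeasurable hm, hmap,
    lintegral_withDensity_eq_lintegral_mul _ (meas_inv n) hIci]
  have h2 : ∫⁻ s in Set.Icc 0 X, ((fun s => (n (Set.Ici s))⁻¹) * fun s => n (Set.Ici s)) s ∂μ
      = ∫⁻ s in Set.Icc 0 X, 1 ∂μ := by
    apply lintegral_congr_ae
    have hae : ∀ᵐ x ∂μ, x ∈ μ.support := Measure.support_mem_ae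
    have h0 : ∀ᵐ x ∂μ, x ≠ 0 := by rw [ae_iff]; simp
    filter_upwards [ae_restrict_of_ae hae, ae_restrict_of_ae h0,
      ae_restrict_mem measurableSet_Icc] with s a b c
    exact ENNReal.inv_mul_cancel (hs s a).ne' (hf s (lt_of_le_of_ne c.1 b.symm)).ne
  rw [h2, setLIntegral_one, mubarDinv, if_pos (DinvSet_nonempty ht), ← hX]
  have h3 : Set.Ici (0:ℝ) = Set.Ico 0 X ∪ Set.Ici X := (Set.Ico_union_Ici_eq_Ici hX0).symm
  have h4 : μ.real (Set.Ici 0) = μ.real (Set.Ico 0 X) + μ.real (Set.Ici X) := by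
    rw [h3]
    apply measureReal_union _ measurableSet_Ici
    rw [Set.disjoint_left]; intro a ha hb; exact absurd ha.2 (not_lt.2 hb)
  rw [h4]
  change _ = ENNReal.ofReal (_ - μ.real (Set.Ici X))
  rw [add_sub_cancel_right, ofReal_measureReal]
  exact (measure_congr Ico_ae_eq_Icc).symm

lemma mubarDinv_le {μ n : Measure ℝ} [IsProbabilityMeasure μ] (v : ℝ≥0∞) :
    mubarDinv μ n v ≤ μ.real (Set.Ici 0) := by
  unfold mubarDinv
  split_ifs
  · exact measureReal_mono (Set.Ici_subset_Ici.2 (sInf_nonneg' _ _ _))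
  · positivity

lemma Dmu_le_of_null {μ n : Measure ℝ} {x y : ℝ} (h : μ (Set.Ioi x) = 0) :
    Dmu μ n y ≤ Dmu μ n x := by
  unfold Dmu
  calc _ ≤ ∫⁻ s in Set.Icc 0 x ∪ Set.Ioi x, (n (Set.Ici s))⁻¹ ∂μ := by
        apply lintegral_mono_set
        intro s hs
        rcases le_or_gt s x with h | h
        · exact Or.inl ⟨hs.1, h⟩
        · exact Or.inr h
    _ ≤ _ + ∫⁻ s in Set.Ioi x, (n (Set.Ici s))⁻¹ ∂μ := lintegral_union_le _ _ _
    _ = _ := by rw [setLIntegral_measure_zero _ _ h, add_zero]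

lemma mubarDinv_pos {μ n : Measure ℝ} [IsProbabilityMeasure μ] [NullSingletonClass μ]
    (hs : ∀ x ∈ μ.support, 0 < n (Set.Ici x)) {v : ℝ≥0∞} 
    (hv : v < ⨆ y, Dmu μ n y) : 0 < mubarDinv μ n v := by
  rw [mubarDinv, if_pos (DinvSet_nonempty hv)]
  refine ENNReal.toReal_pos (fun h => ?_) (measure_ne_top _ _)
  refine absurd hv (not_lt.2 (iSup_le fun y => ?_))
  rw [← Dmu_sInf hs hv]
  exact Dmu_le_of_null (measure_mono_null Set.Ioi_subset_Ici_self h)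

lemma Dmu_lt_sup {μ n : Measure ℝ} [IsProbabilityMeasure μ] 
    (hs : ∀ x ∈ μ.support, 0 < n (Set.Ici x)) (hf : ∀ s, 0 < s → n (Set.Ici s) < ⊤)
    {y : ℝ} (hy : 0 ≤ y) (h : 0 < μ (Set.Ioi y)) : Dmu μ n y < ⨆ y, Dmu μ n y := by
  refine lt_of_le_of_ne (le_iSup _ _) fun he => h.ne' ?_
  have h0 : ∀ z, y ≤ z → μ (Set.Ioc y z) = 0 := by
    intro z hz
    have h1 : Dmu μ n z = Dmu μ n y + ∫⁻ s in Set.Ioc y z, (n (Set.Ici s))⁻¹ ∂μ := by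
      unfold Dmu
      rw [← Set.Icc_union_Ioc_eq_Icc hy hz]
      apply lintegral_union measurableSet_Ioc
      rw [Set.disjoint_left]; intro a ha hb; exact absurd ha.2 (not_le.2 hb.1)
    have h2 : Dmu μ n z ≤ Dmu μ n y := by rw [he]; exact le_iSup (Dmu μ n) z
    have h3 : ∫⁻ s in Set.Ioc y z, (n (Set.Ici s))⁻¹ ∂μ = 0 := by
      rw [h1] at h2
      have := ENNReal.le_of_add_le_add_left (c := 0) (Dmu_lt_top μ n hs y).ne (by simpa using h2)
      simpa using this
    rw [lintegral_eq_zero_iff (meas_inv n)] at h3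
    rw [← Measure.restrict_eq_zero, ← ae_eq_bot]
    rw [← empty_mem_iff_bot]
    filter_upwards [h3, ae_restrict_mem measurableSet_Ioc] with s a b
    exact (hf s (hy.trans_lt b.1)).ne (by simpa using a)
  have : Set.Ioi y = ⋃ k : ℕ, Set.Ioc y (y + k) := by
    ext x
    simp only [Set.mem_Ioi, Set.mem_iUnion, Set.mem_Ioc]
    constructor
    · intro hx
      obtain ⟨k, hk⟩ := exists_nat_ge (x - y)
      exact ⟨k, hx, by linarith⟩
    · rintro ⟨k, hk, _⟩; exact hk
  rw [this, measure_iUnion_null_iff]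
  exact fun k => h0 _ (by simp)

lemma mubarDinv_small {μ n : Measure ℝ} [IsProbabilityMeasure μ] [NullSingletonClass μ]
    (hs : ∀ x ∈ μ.support, 0 < n (Set.Ici x)) (hf : ∀ s, 0 < s → n (Set.Ici s) < ⊤)
    (hp : 0 < μ (Set.Ioi 0)) {ε : ℝ} (hε : 0 < ε) :
    ∃ w, w < (⨆ y, Dmu μ n y) ∧ ∀ v, w ≤ v → mubarDinv μ n v < ε := by
  have hIoi : ∀ y, μ (Set.Ioi y) = 1 - μ (Set.Iic y) := fun y => by
    rw [← Set.compl_Iic, prob_compl_eq_one_sub measurableSet_Iic]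
  have hc : Continuous fun y => μ (Set.Ioi y) := by
    simp_rw [hIoi]
    exact (ENNReal.continuous_sub_left ENNReal.one_ne_top).comp
      (cont_Iic μ fun y => measure_lt_top _ _)
  have ⟨y, hy, h1, h2⟩ : ∃ y, 0 ≤ y ∧ 0 < μ (Set.Ioi y) ∧ μ (Set.Ioi y) < ENNReal.ofReal ε := by
    set δ := min (μ (Set.Ioi 0)) (ENNReal.ofReal (ε / 2)) with hδ
    have hδ0 : 0 < δ := lt_min hp (by simpa using hε)
    have hlim : Tendsto (fun y => μ (Set.Ioi y)) atTop (𝓝 0) := by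
      simp_rw [hIoi]
      have := (ENNReal.continuous_sub_left ENNReal.one_ne_top).continuousAt.tendsto.comp
        (tendsto_measure_Iic_atTop μ)
      simpa [Function.comp_def] using this
    obtain ⟨z, hz, hz0⟩ := ((hlim.eventually_lt_const hδ0).and (eventually_ge_atTop 0)).exists
    obtain ⟨y, hy, hyδ⟩ := intermediate_value_Icc' hz0 hc.continuousOn
      ⟨hz.le, min_le_left _ _⟩
    simp only at hyδ
    refine ⟨y, hy.1, by rw [hyδ]; exact hδ0, ?_⟩
    rw [hyδ]
    exact (min_le_right _ _).trans_lt
      ((ENNReal.ofReal_lt_ofReal_iff hε).2 (by linarith))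
  refine ⟨Dmu μ n y, Dmu_lt_sup hs hf hy h1, fun v hv => ?_⟩
  unfold mubarDinv
  split_ifs with h
  · have : y ≤ sInf (DinvSet μ n v) := by
      apply le_csInf h
      intro z hz
      by_contra hlt
      exact absurd (hv.trans_lt hz.2) (not_lt.2 (Dmu_mono μ n (not_le.1 hlt).le))
    rw [← ENNReal.lt_ofReal_iff_toReal_lt (measure_ne_top _ _)]
    refine lt_of_le_of_lt ?_ h2
    rw [← measure_congr (Ioi_ae_eq_Ici (μ := μ))]
    exact measure_mono (Set.Ioi_subset_Ioi this)
  · exact hε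

lemma log_int {g : ℝ → ℝ≥0∞} (hanti : Antitone g) {t : ℝ} (ht : 0 ≤ t) (F : ℝ → ℝ)
    (hF : ∀ v ∈ Set.Icc 0 t, ∫⁻ x in Set.Ioo 0 v, g x = ENNReal.ofReal (1 - F v))
    (hF1 : ∀ v ∈ Set.Icc 0 t, F v ≤ 1) (hpos : ∀ v ∈ Set.Icc 0 t, 0 < F v)
    (hfin : ∀ v ∈ Set.Ioo 0 t, g v < ⊤) :
    ∫⁻ v in Set.Ioo 0 t, g v * (ENNReal.ofReal (F v))⁻¹ =
      ENNReal.ofReal (-Real.log (F t)) := by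
  set gR : ℝ → ℝ := fun v => (g v).toReal with hgR
  have hgm : Measurable g := hanti.measurable
  have hgRm : Measurable gR := hgm.ennreal_toReal
  have hlin : ∀ v ∈ Set.Icc 0 t, ∫⁻ x in Set.Ioc 0 v, g x = ENNReal.ofReal (1 - F v) := by
    intro v hv
    rw [← hF v hv, setLIntegral_congr Ioo_ae_eq_Ioc]
  have hint : ∀ v ∈ Set.Icc 0 t, IntervalIntegrable gR volume 0 v := by
    intro v hv
    rw [intervalIntegrable_iff_integrableOn_Ioc_of_le hv.1]
    apply integrable_toReal_of_lintegral_ne_top hgm.aemeasurable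
    rw [hlin v hv]; exact ENNReal.ofReal_ne_top
  set K : ℝ → ℝ := fun v => 1 - ∫ x in (0:ℝ)..v, gR x with hK
  have hKF : ∀ v ∈ Set.Icc 0 t, K v = F v := by
    intro v hv
    have hne : ∫⁻ x in Set.Ioc 0 v, g x ≠ ⊤ := by rw [hlin v hv]; exact ENNReal.ofReal_ne_top
    simp only [hK]
    rw [intervalIntegral.integral_of_le hv.1, hgR,
      integral_toReal hgm.aemeasurable (ae_lt_top hgm hne), hlin v hv,
      ENNReal.toReal_ofReal (by linarith [hF1 v hv])]
    ring
  have hKc : ContinuousOn K (Set.Icc 0 t) := by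
    have := intervalIntegral.continuousOn_primitive_interval'
      (hint t ⟨ht, le_rfl⟩) (a := 0) (by simp [ht])
    rw [Set.uIcc_of_le ht] at this
    exact continuousOn_const.sub this
  have hK0 : ∀ v ∈ Set.Icc 0 t, 0 < K v := fun v hv => hKF v hv ▸ hpos v hv
  have hi : IntervalIntegrable (fun v => gR v * (K v)⁻¹) volume 0 t := by
    apply (hint t ⟨ht, le_rfl⟩).mul_continuousOn
    rw [Set.uIcc_of_le ht]
    exact hKc.inv₀ fun v hv => (hK0 v hv).ne'
  have hftc : ∫ v in (0:ℝ)..t, gR v * (K v)⁻¹ = -Real.log (K t) - -Real.log (K 0) := by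
    apply integral_eq_of_hasDerivAt_off_countable_of_le (fun v => -Real.log (K v)) _ ht
      hanti.countable_not_continuousAt
    · exact (hKc.log fun v hv => (hK0 v hv).ne').neg
    · intro v ⟨hv, hc⟩
      have hc : ContinuousAt g v := not_not.1 hc
      have hv' := Set.Ioo_subset_Icc_self hv
      have hcR : ContinuousAt gR v :=
        (ENNReal.continuousAt_toReal (hfin v hv).ne).comp hc
      have hd := intervalIntegral.integral_hasDerivAt_right (hint v hv')
        hgRm.stronglyMeasurable.stronglyMeasurableAtFilter hcR
      have := ((hd.const_sub 1).log (hK0 v hv').ne').neg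
      have e : gR v * (K v)⁻¹ = -(-gR v / (1 - ∫ x in (0:ℝ)..v, gR x)) := by
        simp only [hK]; ring
      rw [e]
      exact this
    · exact hi
  have hK00 : K 0 = 1 := by simp [hK]
  rw [hK00, Real.log_one, neg_zero, sub_zero, hKF t ⟨ht, le_rfl⟩] at hftc
  rw [← hftc, intervalIntegral.integral_of_le ht, setLIntegral_congr Ioo_ae_eq_Ioc.symm.symm,
    ← setIntegral_congr_set (Ioo_ae_eq_Ioc (μ := volume) (a := (0:ℝ)) (b := t)),
    ← setLIntegral_congr Ioo_ae_eq_Ioc]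
  rw [intervalIntegrable_iff_integrableOn_Ioo_of_le ht] at hi
  rw [ofReal_integral_eq_lintegral_ofReal hi]
  · apply setLIntegral_congr_fun measurableSet_Ioo
    intro v hv
    have hv' := Set.Ioo_subset_Icc_self hv
    simp only
    rw [ENNReal.ofReal_mul ENNReal.toReal_nonneg, ENNReal.ofReal_toReal (hfin v hv).ne,
      ENNReal.ofReal_inv_of_pos (hK0 v hv'), hKF v hv']
  · filter_upwards [ae_restrict_mem measurableSet_Ioo] with v hv
    exact mul_nonneg ENNReal.toReal_nonneg
      (inv_nonneg.2 (hK0 v (Set.Ioo_subset_Icc_self hv)).le)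

lemma map_neg_Ici (n : Measure ℝ) (s : ℝ) :
    (n.map Neg.neg) (Set.Ici s) = n (Set.Iic (-s)) := by
  rw [Measure.map_apply measurable_neg measurableSet_Ici]
  congr 1
  ext x; simp only [Set.mem_preimage, Set.mem_Ici, Set.mem_Iic]; exact le_neg

lemma Gmu_eq (μ n : Measure ℝ) (x : ℝ) :
    Gmu μ n x = Dmu (μ.map Neg.neg) (n.map Neg.neg) (-x) := by
  unfold Gmu Dmu
  rw [setLIntegral_map measurableSet_Icc (meas_inv _) measurable_neg]
  simp only [map_neg_Ici, neg_neg]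
  congr 2
  ext y; simp only [Set.mem_preimage, Set.mem_Icc, neg_le_neg_iff, Left.nonneg_neg_iff]; tauto

lemma GinvSet_eq (μ n : Measure ℝ) (v : ℝ≥0∞) :
    GinvSet μ n v = - DinvSet (μ.map Neg.neg) (n.map Neg.neg) v := by
  ext x
  change (x ≤ 0 ∧ v < Gmu μ n x) ↔ (0 ≤ -x ∧ v < Dmu _ _ (-x))
  rw [Gmu_eq, Left.nonneg_neg_iff]

lemma sSup_G (μ n : Measure ℝ) (v : ℝ≥0∞) :
    sSup (GinvSet μ n v) = - sInf (DinvSet (μ.map Neg.neg) (n.map Neg.neg) v) := by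
  rw [GinvSet_eq, Real.sInf_def, neg_neg]

lemma nGinv_eq (μ n : Measure ℝ) (v : ℝ≥0∞) :
    nGinv μ n v = nDinv (μ.map Neg.neg) (n.map Neg.neg) v := by
  unfold nGinv nDinv
  rw [sSup_G, map_neg_Ici, GinvSet_eq]
  simp only [Set.nonempty_neg]

lemma mubarGinv_eq (μ n : Measure ℝ) [IsProbabilityMeasure μ] [NullSingletonClass μ] (v : ℝ≥0∞) :
    mubarGinv μ n v = 1 - mubarDinv (μ.map Neg.neg) (n.map Neg.neg) v := by
  unfold mubarGinv mubarDinv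
  rw [sSup_G, map_neg_Ici, GinvSet_eq]
  simp only [Set.nonempty_neg]
  split_ifs
  · set z := sInf (DinvSet (μ.map Neg.neg) (n.map Neg.neg) v)
    change μ.real _ = 1 - μ.real _
    rw [← probReal_compl_eq_one_sub measurableSet_Iic, Set.compl_Iic]
    exact (measureReal_congr Ioi_ae_eq_Ici).symm
  · simp

lemma supp_D {μ n : Measure ℝ} 
    (hnsupp : ∀ x ∈ measSupport μ, 0 < n (Set.Iic x) ∧ 0 < n (Set.Ici x)) :
    ∀ x ∈ μ.support, 0 < n (Set.Ici x) := fun x hx =>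
  (hnsupp x fun U hU hxU => (Measure.mem_support_iff_forall x).1 hx U (hU.mem_nhds hxU)).2

lemma supp_G {μ n : Measure ℝ} 
    (hnsupp : ∀ x ∈ measSupport μ, 0 < n (Set.Iic x) ∧ 0 < n (Set.Ici x)) :
    ∀ x ∈ (μ.map Neg.neg).support, 0 < (n.map Neg.neg) (Set.Ici x) := by
  intro x hx
  rw [map_neg_Ici]
  refine (hnsupp (-x) fun U hU hxU => ?_).1
  have hV : IsOpen (Neg.neg ⁻¹' U) := hU.preimage continuous_neg
  have := (Measure.mem_support_iff_forall x).1 hx _ (hV.mem_nhds hxU)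
  rw [Measure.map_apply measurable_neg hV.measurableSet] at this
  simpa [Set.preimage_preimage] using this

/-- Set `c_μ = D_μ(∞) = G_μ(−∞)`.  For every `0 ≤ t < c_μ`:
`∫₀^t [n((−∞,G_μ⁻¹(v)]) + n([D_μ⁻¹(v),∞))] / (1 + μ̄(D_μ⁻¹(v)) − μ̄(G_μ⁻¹(v))) dv
  = −log(1 + μ̄(D_μ⁻¹(t)) − μ̄(G_μ⁻¹(t)))`.
Consequently, the same integral taken over `[0, c_μ)` equals `+∞`. -/
theorem logIdentityAndDivergence
    (μ n : MeasureTheory.Measure ℝ) [MeasureTheory.IsProbabilityMeasure μ]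
    (hatomless : ∀ x : ℝ, μ {x} = 0)
    (hneg : 0 < μ (Set.Iio (0 : ℝ))) (hpos : 0 < μ (Set.Ioi (0 : ℝ)))
    (hnfin : ∀ s : ℝ, 0 < s → n (Set.Ici s) < ⊤ ∧ n (Set.Iic (-s)) < ⊤)
    (hnsupp : ∀ x ∈ measSupport μ, 0 < n (Set.Iic x) ∧ 0 < n (Set.Ici x))
    (hcompat : (⨆ y : ℝ, Dmu μ n y) = (⨆ x : ℝ, Gmu μ n x))
    :
    (∀ t : ℝ, 0 ≤ t → ENNReal.ofReal t < (⨆ y : ℝ, Dmu μ n y) →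
      (∫⁻ v in Set.Ioo (0 : ℝ) t,
          (nGinv μ n (ENNReal.ofReal v) + nDinv μ n (ENNReal.ofReal v)) *
            (ENNReal.ofReal
              (1 + mubarDinv μ n (ENNReal.ofReal v) - mubarGinv μ n (ENNReal.ofReal v)))⁻¹)
        = ENNReal.ofReal
            (-(Real.log
                (1 + mubarDinv μ n (ENNReal.ofReal t) - mubarGinv μ n (ENNReal.ofReal t))))) ∧
    (∫⁻ v in {v : ℝ | 0 ≤ v ∧ ENNReal.ofReal v < (⨆ y : ℝ, Dmu μ n y)},
        (nGinv μ n (ENNReal.ofReal v) + nDinv μ n (ENNReal.ofReal v)) *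
          (ENNReal.ofReal
            (1 + mubarDinv μ n (ENNReal.ofReal v) - mubarGinv μ n (ENNReal.ofReal v)))⁻¹)
      = ⊤ := by
  haveI : NullSingletonClass μ := ⟨hatomless⟩
  set μ' := μ.map Neg.neg with hμ'
  set n' := n.map Neg.neg with hn'
  haveI : IsProbabilityMeasure μ' := Measure.isProbabilityMeasure_map measurable_neg.aemeasurable
  haveI : NullSingletonClass μ' := ⟨fun x => by
    rw [hμ', Measure.map_apply measurable_neg (measurableSet_singleton x)]
    have : (Neg.neg ⁻¹' {x} : Set ℝ) = {-x} := by
      ext y; simp [neg_eq_iff_eq_neg]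
    rw [this, hatomless]⟩
  have hs := supp_D hnsupp
  have hs' : ∀ x ∈ μ'.support, 0 < n' (Set.Ici x) := supp_G hnsupp
  have hf : ∀ s, 0 < s → n (Set.Ici s) < ⊤ := fun s h => (hnfin s h).1
  have hf' : ∀ s, 0 < s → n' (Set.Ici s) < ⊤ := fun s h => by
    rw [hn', map_neg_Ici]; exact (hnfin s h).2
  have hp' : 0 < μ' (Set.Ioi 0) := by
    rw [hμ', Measure.map_apply measurable_neg measurableSet_Ioi]
    have : (Neg.neg ⁻¹' Set.Ioi 0 : Set ℝ) = Set.Iio 0 := by ext y; simp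
    rwa [this]
  have hc : (⨆ y : ℝ, Dmu μ n y) = ⨆ y, Dmu μ' n' y := by
    rw [hcompat]
    simp_rw [Gmu_eq]
    exact (Equiv.neg ℝ).iSup_comp (g := Dmu μ' n')
  have hone : μ.real (Set.Ici 0) + μ'.real (Set.Ici 0) = 1 := by
    have : μ'.real (Set.Ici 0) = μ.real (Set.Iio 0) := by
      rw [measureReal_def, hμ', map_neg_Ici, neg_zero, ← measure_congr (Iio_ae_eq_Iic (μ := μ))]
      rfl
    rw [this, ← Set.compl_Ici, probReal_compl_eq_one_sub measurableSet_Ici]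
    ring
  set c := ⨆ y : ℝ, Dmu μ n y with hcdef
  set F : ℝ → ℝ := fun v =>
    1 + mubarDinv μ n (ENNReal.ofReal v) - mubarGinv μ n (ENNReal.ofReal v) with hFdef
  have hFeq : ∀ v, F v = mubarDinv μ n (ENNReal.ofReal v) + mubarDinv μ' n' (ENNReal.ofReal v) := by
    intro v
    simp only [hFdef, mubarGinv_eq]
    ring
  set g : ℝ → ℝ≥0∞ := fun v =>
    nGinv μ n (ENNReal.ofReal v) + nDinv μ n (ENNReal.ofReal v) with hg
  have hganti : Antitone g := by
    intro v w h
    have h' := ENNReal.ofReal_le_ofReal h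
    simp only [hg, nGinv_eq]
    exact add_le_add (nDinv_anti _ _ h') (nDinv_anti _ _ h')
  have hm' : Measurable fun v : ℝ => nDinv μ' n' (ENNReal.ofReal v) :=
    Antitone.measurable fun v w h => nDinv_anti _ _ (ENNReal.ofReal_le_ofReal h)
  have hFpos : ∀ v, ENNReal.ofReal v < c → 0 < F v := by
    intro v hv
    rw [hFeq]
    exact add_pos (mubarDinv_pos hs hv) (mubarDinv_pos hs' (hc ▸ hv))
  have part1 : ∀ t : ℝ, 0 ≤ t → ENNReal.ofReal t < c →
      (∫⁻ v in Set.Ioo (0 : ℝ) t, g v * (ENNReal.ofReal (F v))⁻¹) =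
        ENNReal.ofReal (-(Real.log (F t))) := by
    intro t ht htc
    have hlt : ∀ v, v ≤ t → ENNReal.ofReal v < c := fun v hv =>
      (ENNReal.ofReal_le_ofReal hv).trans_lt htc
    apply log_int hganti ht F
    · intro v hv
      have hvc := hlt v hv.2
      simp only [hg, nGinv_eq]
      rw [lintegral_add_left hm', lint_nDinv hs hf hvc, lint_nDinv hs' hf' (hc ▸ hvc),
        ← ENNReal.ofReal_add (sub_nonneg.2 (mubarDinv_le _)) (sub_nonneg.2 (mubarDinv_le _)),
        hFeq, ← hone]
      congr 1
      ring
    · intro v hv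
      rw [hFeq, ← hone]
      exact add_le_add (mubarDinv_le _) (mubarDinv_le _)
    · exact fun v hv => hFpos v (hlt v hv.2)
    · intro v hv
      have hvc := hlt v hv.2.le
      have h0 : 0 < ENNReal.ofReal v := ENNReal.ofReal_pos.2 hv.1
      simp only [hg, nGinv_eq]
      exact ENNReal.add_lt_top.2 ⟨nDinv_lt_top hs' hf' h0 (hc ▸ hvc), nDinv_lt_top hs hf h0 hvc⟩
  refine ⟨part1, ?_⟩
  change (∫⁻ v in {v : ℝ | 0 ≤ v ∧ ENNReal.ofReal v < c}, g v * (ENNReal.ofReal (F v))⁻¹) = ⊤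
  refine ENNReal.eq_top_of_forall_nnreal_le fun r => ?_
  have he : 0 < Real.exp (-(r:ℝ)) / 2 := by positivity
  obtain ⟨w, hw, hwε⟩ := mubarDinv_small hs hf hpos he
  obtain ⟨w', hw', hwε'⟩ := mubarDinv_small hs' hf' hp' he
  have hmax : max w w' < c := max_lt hw (hc ▸ hw')
  have hmt : max w w' ≠ ⊤ := hmax.ne_top
  set t := (max w w').toReal with htdef
  have hot : ENNReal.ofReal t = max w w' := ENNReal.ofReal_toReal hmt
  have ht0 : 0 ≤ t := ENNReal.toReal_nonneg
  have htc : ENNReal.ofReal t < c := hot ▸ hmax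
  calc (r : ℝ≥0∞) = ENNReal.ofReal r := by simp
    _ ≤ ENNReal.ofReal (-(Real.log (F t))) := by
        apply ENNReal.ofReal_le_ofReal
        have h1 : F t ≤ Real.exp (-(r:ℝ)) := by
          rw [hFeq, hot]
          linarith [hwε _ (le_max_left w w'), hwε' _ (le_max_right w w')]
        have := Real.log_le_log (hFpos t htc) h1
        rw [Real.log_exp] at this
        linarith
    _ = _ := (part1 t ht0 htc).symm
    _ ≤ _ := by
        apply lintegral_mono_set
        intro v hv
        exact ⟨hv.1.le, (ENNReal.ofReal_le_ofReal hv.2.le).trans_lt htc⟩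
end
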